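/- Let n ≥ 1, a > 1 and 1 < α < (n+2a+2)/(n+2a-2). Suppose u : ℝⁿ × [0,∞) → ℝ is nonnegative, of class C² up to the boundary (i.e., u together with its first and second partial derivatives extends continuously to {y = 0}), and satisfies y·∂²u/∂y² + a·∂u/∂y + Δₓu + u^α = 0 at every point of ℝⁿ × (0,∞), where Δₓ = Σᵢ₌₁ⁿ ∂²/∂xᵢ². Then u ≡ 0. -/

import Mathlib

/-- Second partial derivative in the `i`-th `x`-variable. -/
noncomputable def pdxx (n : ℕ) (u : (Fin n → ℝ) × ℝ → ℝ) (i : Fin n)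
    (x : Fin n → ℝ) (y : ℝ) : ℝ :=
  deriv (fun t => deriv (fun s => u (Function.update x i s, y)) t) (x i)

/-- First partial derivative in the `y`-variable. -/
noncomputable def pdy (n : ℕ) (u : (Fin n → ℝ) × ℝ → ℝ) (x : Fin n → ℝ) (y : ℝ) : ℝ :=
  deriv (fun t => u (x, t)) y

/-- Second partial derivative in the `y`-variable. -/
noncomputable def pdyy (n : ℕ) (u : (Fin n → ℝ) × ℝ → ℝ) (x : Fin n → ℝ) (y : ℝ) : ℝ :=
  deriv (fun t => deriv (fun s => u (x, s)) t) y

open Set Filter Topology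

section oneD
variable {g h : ℝ → ℝ} {t : ℝ}

theorem c2_ev (hg : ContDiffAt ℝ 2 g t) : ∀ᶠ s in 𝓝 t, DifferentiableAt ℝ g s := by
  filter_upwards [hg.eventually (by simp)] with s hs
  exact hs.differentiableAt (by norm_num)

theorem c2_d (hg : ContDiffAt ℝ 2 g t) : DifferentiableAt ℝ (deriv g) t := by
  have : ContDiffAt ℝ 1 (deriv g) t := by
    have h2 : ContDiffAt ℝ (1+1) g t := by norm_num; exact hg
    exact ContDiffAt.derivWithin h2 le_rfl
  exact this.differentiableAt (by norm_num)

theorem dd_add (hg : ContDiffAt ℝ 2 g t) (hh : ContDiffAt ℝ 2 h t) :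
    deriv (deriv (fun s => g s + h s)) t = deriv (deriv g) t + deriv (deriv h) t := by
  have : deriv (fun s => g s + h s) =ᶠ[𝓝 t] fun s => deriv g s + deriv h s := by
    filter_upwards [c2_ev hg, c2_ev hh] with s h1 h2
    exact deriv_fun_add h1 h2
  rw [this.deriv_eq]
  exact deriv_fun_add (c2_d hg) (c2_d hh)

theorem dd_mul (hg : ContDiffAt ℝ 2 g t) (hh : ContDiffAt ℝ 2 h t) :
    deriv (deriv (fun s => g s * h s)) t =
      deriv (deriv g) t * h t + 2 * (deriv g t * deriv h t) + g t * deriv (deriv h) t := by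
  have : deriv (fun s => g s * h s) =ᶠ[𝓝 t] fun s => deriv g s * h s + g s * deriv h s := by
    filter_upwards [c2_ev hg, c2_ev hh] with s h1 h2
    exact deriv_fun_mul h1 h2
  rw [this.deriv_eq]
  have e1 := (c2_ev hg).self_of_nhds
  have e2 := (c2_ev hh).self_of_nhds
  rw [deriv_fun_add ((c2_d hg).fun_mul e2) (e1.fun_mul (c2_d hh)), deriv_fun_mul (c2_d hg) e2,
    deriv_fun_mul e1 (c2_d hh)]
  ring

theorem dd_comp {k : ℝ → ℝ} (hg : ContDiffAt ℝ 2 g t) (hk : ContDiffAt ℝ 2 k (g t)) :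
    deriv (deriv (fun s => k (g s))) t =
      deriv (deriv k) (g t) * deriv g t ^ 2 + deriv k (g t) * deriv (deriv g) t := by
  have e1 := (c2_ev hg).self_of_nhds
  have : deriv (fun s => k (g s)) =ᶠ[𝓝 t] fun s => deriv k (g s) * deriv g s := by
    filter_upwards [c2_ev hg, e1.continuousAt.eventually (c2_ev hk)] with s h1 h2
    exact deriv_comp s h2 h1
  rw [this.deriv_eq]
  have e3 : HasDerivAt (fun s => deriv k (g s)) (deriv (deriv k) (g t) * deriv g t) t :=
    (c2_d hk).hasDerivAt.comp t e1.hasDerivAt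
  rw [(e3.fun_mul (c2_d hg).hasDerivAt).deriv]
  ring

theorem dd_min (hg : ContDiffAt ℝ 2 g t) (hm : IsLocalMin g t) : 0 ≤ deriv (deriv g) t := by
  by_contra hlt
  push Not at hlt
  have hM := isLocalMax_of_deriv_deriv_neg hlt hm.deriv_eq_zero hg.continuousAt
  have : g =ᶠ[𝓝 t] fun _ => g t := by
    filter_upwards [hm, hM] with s h1 h2
    exact le_antisymm h2 h1
  have h2 := this.deriv.deriv_eq
  simp at h2
  linarith
end oneD

/-- the ambient space -/
abbrev EE (n : ℕ) := (Fin n → ℝ) × ℝ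

noncomputable def D1 {n : ℕ} (f : EE n → ℝ) (z v : EE n) : ℝ := deriv (fun t : ℝ => f (z + t • v)) 0
noncomputable def D2 {n : ℕ} (f : EE n → ℝ) (z v : EE n) : ℝ :=
  deriv (deriv (fun t : ℝ => f (z + t • v))) 0
def ey {n : ℕ} : EE n := (0, 1)
def ex {n : ℕ} (i : Fin n) : EE n := (Pi.single i 1, 0)
noncomputable def LF {n : ℕ} (a : ℝ) (f : EE n → ℝ) (z : EE n) : ℝ :=
  z.2 * D2 f z ey + a * D1 f z ey + ∑ i, D2 f z (ex i)
noncomputable def GG {n : ℕ} (f g : EE n → ℝ) (z : EE n) : ℝ :=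
  z.2 * (D1 f z ey * D1 g z ey) + ∑ i, D1 f z (ex i) * D1 g z (ex i)

section lcalc
variable {n : ℕ} {a : ℝ} {f g : EE n → ℝ} {z : EE n}

theorem line_c2 (hf : ContDiffAt ℝ 2 f z) (v : EE n) :
    ContDiffAt ℝ 2 (fun t : ℝ => f (z + t • v)) 0 := by
  have h1 : ContDiffAt ℝ 2 (fun t : ℝ => z + t • v) 0 := by fun_prop
  exact ContDiffAt.comp (g := f) (0:ℝ) (by simpa using hf) h1

theorem line_d (hf : ContDiffAt ℝ 2 f z) (v : EE n) :
    DifferentiableAt ℝ (fun t : ℝ => f (z + t • v)) 0 :=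
  (line_c2 hf v).differentiableAt (by norm_num)

theorem LF_add (hf : ContDiffAt ℝ 2 f z) (hg : ContDiffAt ℝ 2 g z) :
    LF a (fun w => f w + g w) z = LF a f z + LF a g z := by
  have h2 : ∀ v, D2 (fun w => f w + g w) z v = D2 f z v + D2 g z v := fun v =>
    dd_add (line_c2 hf v) (line_c2 hg v)
  have h1 : ∀ v, D1 (fun w => f w + g w) z v = D1 f z v + D1 g z v := fun v =>
    deriv_fun_add (line_d hf v) (line_d hg v)
  simp only [LF, h1, h2, Finset.sum_add_distrib]
  ring

theorem LF_mul (hf : ContDiffAt ℝ 2 f z) (hg : ContDiffAt ℝ 2 g z) :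
    LF a (fun w => f w * g w) z = LF a f z * g z + 2 * GG f g z + f z * LF a g z := by
  have h2 : ∀ v, D2 (fun w => f w * g w) z v
      = D2 f z v * g z + 2 * (D1 f z v * D1 g z v) + f z * D2 g z v := fun v => by
    have := dd_mul (line_c2 hf v) (line_c2 hg v)
    simpa [D1, D2] using this
  have h1 : ∀ v, D1 (fun w => f w * g w) z v = D1 f z v * g z + f z * D1 g z v := fun v => by
    have := deriv_fun_mul (line_d hf v) (line_d hg v)
    simpa [D1] using this
  simp only [LF, GG, h1, h2, Finset.sum_add_distrib, ← Finset.sum_mul, ← Finset.mul_sum]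
  ring

theorem D1_comp {k : ℝ → ℝ} (hf : ContDiffAt ℝ 2 f z) (hk : ContDiffAt ℝ 2 k (f z)) (v : EE n) :
    D1 (fun w => k (f w)) z v = deriv k (f z) * D1 f z v := by
  have := deriv_comp (h₂ := k) (h := fun t : ℝ => f (z + t • v)) (0:ℝ)
    (by simpa using hk.differentiableAt (by norm_num)) (line_d hf v)
  simpa [D1, Function.comp_def] using this

theorem LF_comp {k : ℝ → ℝ} (hf : ContDiffAt ℝ 2 f z) (hk : ContDiffAt ℝ 2 k (f z)) :
    LF a (fun w => k (f w)) z = deriv (deriv k) (f z) * GG f f z + deriv k (f z) * LF a f z := by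
  have h2 : ∀ v, D2 (fun w => k (f w)) z v
      = deriv (deriv k) (f z) * (D1 f z v * D1 f z v) + deriv k (f z) * D2 f z v := fun v => by
    have := dd_comp (k := k) (line_c2 hf v) (by simpa using hk)
    simpa [D1, D2, sq] using this
  simp only [LF, GG, D1_comp hf hk, h2, Finset.sum_add_distrib, ← Finset.mul_sum]
  ring

theorem LF_min (hz : 0 < z.2) (hf : ContDiffAt ℝ 2 f z) (hm : IsLocalMin f z) :
    0 ≤ LF a f z := by
  have hl : ∀ v : EE n, IsLocalMin (fun t : ℝ => f (z + t • v)) 0 := fun v => by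
    have hc : ContinuousAt (fun t : ℝ => z + t • v) 0 := by fun_prop
    have := hc.eventually (p := fun w => f z ≤ f w) (by beta_reduce; rw [zero_smul, add_zero]; exact hm)
    simpa [IsLocalMin, IsMinFilter] using this
  have h1 : ∀ v, D1 f z v = 0 := fun v => (hl v).deriv_eq_zero
  have h2 : ∀ v, 0 ≤ D2 f z v := fun v => dd_min (line_c2 hf v) (hl v)
  simp only [LF, h1]
  have := Finset.sum_nonneg (s := Finset.univ) (fun i _ => h2 (ex i))
  have := mul_nonneg hz.le (h2 ey)
  linarith

theorem D1_congr {z v : EE n} (h : f =ᶠ[𝓝 z] g) : D1 f z v = D1 g z v := by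
  have hc : ContinuousAt (fun t : ℝ => z + t • v) 0 := by fun_prop
  have : ∀ᶠ t in 𝓝 (0:ℝ), f (z + t • v) = g (z + t • v) :=
    hc.eventually (p := fun w => f w = g w) (by beta_reduce; rw [zero_smul, add_zero]; exact h)
  exact Filter.EventuallyEq.deriv_eq this

theorem D2_congr {z v : EE n} (h : f =ᶠ[𝓝 z] g) : D2 f z v = D2 g z v := by
  have hc : ContinuousAt (fun t : ℝ => z + t • v) 0 := by fun_prop
  have : ∀ᶠ t in 𝓝 (0:ℝ), f (z + t • v) = g (z + t • v) :=
    hc.eventually (p := fun w => f w = g w) (by beta_reduce; rw [zero_smul, add_zero]; exact h)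
  exact (Filter.EventuallyEq.deriv this).deriv_eq

theorem LF_cmul (c : ℝ) : LF a (fun w => c * f w) z = c * LF a f z := by
  simp only [LF, D1, D2, deriv_const_mul_field', deriv_const_mul_field, ← Finset.mul_sum]
  ring

theorem LF_const (c : ℝ) : LF a (fun _ : EE n => c) z = 0 := by
  simp [LF, D1, D2]

/-- squared distance in x -/
def XX {n : ℕ} (p : Fin n → ℝ) (z : EE n) : ℝ := ∑ i, (z.1 i - p i) ^ 2

theorem XX_c2 (p : Fin n → ℝ) : ContDiff ℝ 2 (XX p) := by unfold XX; fun_prop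
theorem y_c2 : ContDiff ℝ 2 (fun z : EE n => z.2) := by fun_prop

theorem XX_ey (p : Fin n → ℝ) (t : ℝ) : XX p (z + t • ey) = XX p z := by simp [XX, ey]
theorem XX_ex (p : Fin n → ℝ) (t : ℝ) (i : Fin n) :
    XX p (z + t • ex i) = XX p z + 2 * t * (z.1 i - p i) + t ^ 2 := by
  have : ∀ j, ((z + t • ex i).1 j - p j) ^ 2
      = (z.1 j - p j) ^ 2 + if j = i then 2 * t * (z.1 i - p i) + t ^ 2 else 0 := by
    intro j
    by_cases hj : j = i
    · subst hj; simp [ex]; ring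
    · simp [ex, hj]
  simp only [XX, this, Finset.sum_add_distrib]
  simp; ring

theorem y_ey (t : ℝ) : (z + t • ey).2 = z.2 + t := by simp [ey]
theorem y_ex (t : ℝ) (i : Fin n) : (z + t • ex i).2 = z.2 := by simp [ex]

theorem quad_d (A B C : ℝ) : deriv (fun t : ℝ => A + 2 * t * B + C * t ^ 2) = fun t => 2 * B + C * (2 * t) := by
  funext t
  have : HasDerivAt (fun t : ℝ => A + 2 * t * B + C * t ^ 2) (2 * B + C * (2 * t)) t := by
    have h := ((hasDerivAt_id' t).const_mul 2 |>.mul_const B |>.const_add A).fun_add (((hasDerivAt_id' t).fun_pow 2).const_mul C)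
    exact h.congr_deriv (by simp)
  exact this.deriv

theorem quad_dd (A B C : ℝ) (t : ℝ) : deriv (deriv (fun t : ℝ => A + 2 * t * B + C * t ^ 2)) t = 2 * C := by
  rw [quad_d]
  have : HasDerivAt (fun t : ℝ => 2 * B + C * (2 * t)) (2 * C) t := by
    have h := (((hasDerivAt_id' t).const_mul 2).const_mul C).const_add (2 * B)
    exact h.congr_deriv (by ring)
  exact this.deriv

theorem D1_XX_ey (p : Fin n → ℝ) : D1 (XX p) z ey = 0 := by simp [D1, XX_ey]
theorem D2_XX_ey (p : Fin n → ℝ) : D2 (XX p) z ey = 0 := by simp [D2, XX_ey]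
theorem D1_XX_ex (p : Fin n → ℝ) (i : Fin n) : D1 (XX p) z (ex i) = 2 * (z.1 i - p i) := by
  have := congrFun (quad_d (XX p z) (z.1 i - p i) 1) 0
  simp only [one_mul] at this
  simp only [D1, XX_ex, this]; ring
theorem D2_XX_ex (p : Fin n → ℝ) (i : Fin n) : D2 (XX p) z (ex i) = 2 := by
  have := quad_dd (XX p z) (z.1 i - p i) 1 0
  simp only [one_mul] at this
  simp only [D2, XX_ex, this]; ring
theorem D1_y_ey : D1 (fun w : EE n => w.2) z ey = 1 := by
  simp [D1, ey]
theorem D2_y_ey : D2 (fun w : EE n => w.2) z ey = 0 := by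
  have : deriv (fun t : ℝ => z.2 + t) = fun _ => 1 := by funext t; simp
  simp only [D2, y_ey, this]; simp
theorem D1_y_ex (i : Fin n) : D1 (fun w : EE n => w.2) z (ex i) = 0 := by simp [D1, ex]
theorem D2_y_ex (i : Fin n) : D2 (fun w : EE n => w.2) z (ex i) = 0 := by simp [D2, ex]

theorem LF_XX (p : Fin n → ℝ) : LF a (XX p) z = 2 * n := by
  simp [LF, D1_XX_ey, D2_XX_ey, D2_XX_ex]; ring
theorem GG_XX (p : Fin n → ℝ) : GG (XX p) (XX p) z = 4 * XX p z := by
  simp only [GG, D1_XX_ey, D1_XX_ex, XX, Finset.mul_sum]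
  simp; congr 1; funext i; ring
theorem LF_y : LF a (fun w : EE n => w.2) z = a := by
  simp [LF, D1_y_ey, D2_y_ey, D2_y_ex]
theorem GG_y : GG (fun w : EE n => w.2) (fun w : EE n => w.2) z = z.2 := by
  simp [GG, D1_y_ey, D1_y_ex]

/-- separated functions -/
theorem LF_sep (p : Fin n → ℝ) {A B : ℝ → ℝ} (hA : ContDiffAt ℝ 2 A (XX p z))
    (hB : ContDiffAt ℝ 2 B z.2) :
    LF a (fun w => A (XX p w) * B w.2) z =
      (4 * XX p z * deriv (deriv A) (XX p z) + 2 * n * deriv A (XX p z)) * B z.2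
      + A (XX p z) * (z.2 * deriv (deriv B) z.2 + a * deriv B z.2) := by
  have hX := (XX_c2 p).contDiffAt (x := z)
  have hY := (y_c2).contDiffAt (x := z)
  have c1 : ContDiffAt ℝ 2 (fun w => A (XX p w)) z := ContDiffAt.comp (g := A) z hA hX
  have c2 : ContDiffAt ℝ 2 (fun w : EE n => B w.2) z := ContDiffAt.comp (g := B) z hB hY
  rw [LF_mul c1 c2, LF_comp hX hA, LF_comp (f := fun w : EE n => w.2) hY hB]
  have : GG (fun w => A (XX p w)) (fun w : EE n => B w.2) z = 0 := by
    simp only [GG]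
    simp [D1_comp hX hA, D1_comp (f := fun w : EE n => w.2) hY hB, D1_XX_ey, D1_y_ex]
  rw [this, GG_XX, LF_XX, GG_y, LF_y]
  ring

/-- functions of c X + B(y) -/
theorem GG_sum (p : Fin n → ℝ) (c : ℝ) {B : ℝ → ℝ} (hB : ContDiffAt ℝ 2 B z.2) :
    GG (fun w => c * XX p w + B w.2) (fun w => c * XX p w + B w.2) z =
      4 * c ^ 2 * XX p z + z.2 * deriv B z.2 ^ 2 := by
  have hX := (XX_c2 p).contDiffAt (x := z)
  have hY := (y_c2).contDiffAt (x := z)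
  have c1 : ContDiffAt ℝ 2 (fun w => c * XX p w) z := contDiffAt_const.mul hX
  have c2 : ContDiffAt ℝ 2 (fun w : EE n => B w.2) z := ContDiffAt.comp (g := B) z hB hY
  have h1 : ∀ v, D1 (fun w => c * XX p w + B w.2) z v
      = c * D1 (XX p) z v + deriv B z.2 * D1 (fun w : EE n => w.2) z v := fun v => by
    have := deriv_fun_add (line_d c1 v) (line_d c2 v)
    rw [← D1_comp (f := fun w : EE n => w.2) hY hB]
    simp only [D1] at this ⊢
    rw [this, deriv_const_mul_field]
  simp only [GG, h1, D1_XX_ey, D1_XX_ex, D1_y_ey, D1_y_ex]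
  simp only [XX, Finset.mul_sum]
  rw [add_comm]
  congr 1
  · congr 1; funext i; ring
  · ring

theorem LF_sum (p : Fin n → ℝ) (c : ℝ) {B : ℝ → ℝ} (hB : ContDiffAt ℝ 2 B z.2) :
    LF a (fun w => c * XX p w + B w.2) z =
      2 * n * c + z.2 * deriv (deriv B) z.2 + a * deriv B z.2 := by
  have hX := (XX_c2 p).contDiffAt (x := z)
  have hY := (y_c2).contDiffAt (x := z)
  have c1 : ContDiffAt ℝ 2 (fun w => c * XX p w) z := contDiffAt_const.mul hX
  have c2 : ContDiffAt ℝ 2 (fun w : EE n => B w.2) z := ContDiffAt.comp (g := B) z hB hY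
  rw [LF_add c1 c2, LF_cmul, LF_XX, LF_comp (f := fun w : EE n => w.2) hY hB, GG_y, LF_y]
  ring

theorem sum_c2 (p : Fin n → ℝ) (c : ℝ) {B : ℝ → ℝ} (hB : ContDiffAt ℝ 2 B z.2) :
    ContDiffAt ℝ 2 (fun w => c * XX p w + B w.2) z :=
  (contDiffAt_const.mul (XX_c2 p).contDiffAt).add
    (ContDiffAt.comp (g := B) z hB y_c2.contDiffAt)

end lcalc

open Set Filter Topology

section kelvin
variable {n : ℕ} {a : ℝ}

def rh {n : ℕ} (z : EE n) : ℝ := XX 0 z + 4 * z.2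

theorem rh_c2 : ContDiff ℝ 2 (rh (n := n)) := by
  unfold rh; exact (XX_c2 0).add (contDiff_const.mul y_c2)

theorem rh_eq : (rh (n := n)) = fun w => 1 * XX 0 w + (fun y => 4 * y) w.2 := by
  funext w; simp [rh]

theorem LF_rh (z : EE n) : LF a rh z = 2 * n + 4 * a := by
  rw [rh_eq, LF_sum (B := fun y => 4 * y) 0 1 (by fun_prop)]
  have : deriv (fun y : ℝ => 4 * y) = fun _ => 4 := by funext t; simp
  rw [this]; simp; ring

theorem GG_rh (z : EE n) : GG rh rh z = 4 * rh z := by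
  have : deriv (fun y : ℝ => 4 * y) = fun _ => 4 := by funext t; simp
  nth_rewrite 1 [rh_eq]
  nth_rewrite 1 [rh_eq]
  rw [GG_sum (B := fun y => 4 * y) 0 1 (by fun_prop)]
  rw [this]; simp [rh]; ring

theorem D1_rh_ey (z : EE n) : D1 rh z ey = 4 := by
  simp only [D1, rh, XX_ey, y_ey]
  simp
theorem rh_ex (z : EE n) (t : ℝ) (i : Fin n) : rh (z + t • ex i) = rh z + 2 * t * z.1 i + t ^ 2 := by
  simp only [rh, XX_ex, y_ex]; simp; ring
theorem rh_ey (z : EE n) (t : ℝ) : rh (z + t • ey) = rh z + 4 * t := by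
  simp only [rh, XX_ey, y_ey]; ring
theorem D1_rh_ex (z : EE n) (i : Fin n) : D1 rh z (ex i) = 2 * z.1 i := by
  have := congrFun (quad_d (rh z) (z.1 i) 1) 0
  simp only [one_mul] at this
  simp only [D1, rh_ex, this]; ring

theorem pow_d (c p r : ℝ) (_hr : 0 < r) : deriv (fun t : ℝ => c * t ^ p) r = c * (p * r ^ (p - 1)) := by
  simp [Real.deriv_rpow_const]

theorem pow_dd (c p r : ℝ) (hr : 0 < r) :
    deriv (deriv (fun t : ℝ => c * t ^ p)) r = c * (p * ((p - 1) * r ^ (p - 2))) := by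
  have : deriv (fun t : ℝ => c * t ^ p) =ᶠ[𝓝 r] fun t => (c * p) * t ^ (p - 1) := by
    filter_upwards [lt_mem_nhds hr] with t ht
    rw [pow_d _ _ _ ht]; ring
  rw [this.deriv_eq, pow_d _ _ _ hr]
  ring_nf

theorem pow_c2 (c p r : ℝ) (hr : 0 < r) : ContDiffAt ℝ 2 (fun t : ℝ => c * t ^ p) r :=
  contDiffAt_const.mul (Real.contDiffAt_rpow_const_of_ne hr.ne')

theorem LF_fund (z : EE n) (hz : 0 < rh z) (c m : ℝ) (hm : m = n / 2 + a - 1) :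
    LF a (fun w => c * rh w ^ (-m)) z = 0 := by
  rw [LF_comp (k := fun t => c * t ^ (-m)) rh_c2.contDiffAt (pow_c2 _ _ _ hz), pow_d _ _ _ hz,
    pow_dd _ _ _ hz, LF_rh, GG_rh]
  have : rh z ^ (-m - 1) = rh z ^ (-m - 2) * rh z := by
    rw [← Real.rpow_add_one hz.ne']; ring_nf
  rw [this, hm]; ring

theorem curve {F : Type*} [NormedAddCommGroup F] [NormedSpace ℝ F] {u : F → ℝ} {c c1 : ℝ → F} {c2 : F}
    (hu : ContDiffAt ℝ 2 u (c 0)) (h1 : ∀ᶠ t in 𝓝 (0:ℝ), HasDerivAt c (c1 t) t)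
    (h2 : HasDerivAt c1 c2 0) :
    deriv (fun t => u (c t)) 0 = fderiv ℝ u (c 0) (c1 0) ∧
    deriv (deriv (fun t => u (c t))) 0 =
      fderiv ℝ (fderiv ℝ u) (c 0) (c1 0) (c1 0) + fderiv ℝ u (c 0) c2 := by
  have hd : ∀ᶠ w in 𝓝 (c 0), DifferentiableAt ℝ u w := by
    filter_upwards [hu.eventually (by simp)] with s hs
    exact hs.differentiableAt (by norm_num)
  have hc0 := h1.self_of_nhds
  have e1 : deriv (fun t => u (c t)) =ᶠ[𝓝 0] fun t => fderiv ℝ u (c t) (c1 t) := by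
    filter_upwards [h1, hc0.continuousAt.eventually hd] with t ht hut
    exact (hut.hasFDerivAt.comp_hasDerivAt t ht).deriv
  refine ⟨e1.self_of_nhds, ?_⟩
  rw [e1.deriv_eq]
  have hdd : DifferentiableAt ℝ (fderiv ℝ u) (c 0) :=
    (hu.fderiv_right (m := 1) (by norm_num)).differentiableAt (by norm_num)
  have := (hdd.hasFDerivAt.comp_hasDerivAt (0:ℝ) hc0).clm_apply h2
  exact this.deriv

theorem curve3 {F : Type*} [NormedAddCommGroup F] [NormedSpace ℝ F] {u : F → ℝ} {A B C : ℝ → ℝ}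
    (X Y Z : F) 
    (hA : ContDiffAt ℝ 2 A 0) (hB : ContDiffAt ℝ 2 B 0) (hC : ContDiffAt ℝ 2 C 0)
    (hu : ContDiffAt ℝ 2 u (A 0 • X + B 0 • Y + C 0 • Z)) :
    deriv (fun t => u (A t • X + B t • Y + C t • Z)) 0 = fderiv ℝ u (A 0 • X + B 0 • Y + C 0 • Z)
      (deriv A 0 • X + deriv B 0 • Y + deriv C 0 • Z) ∧
    deriv (deriv (fun t => u (A t • X + B t • Y + C t • Z))) 0 =
      fderiv ℝ (fderiv ℝ u) (A 0 • X + B 0 • Y + C 0 • Z)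
        (deriv A 0 • X + deriv B 0 • Y + deriv C 0 • Z)
        (deriv A 0 • X + deriv B 0 • Y + deriv C 0 • Z) +
      fderiv ℝ u (A 0 • X + B 0 • Y + C 0 • Z)
       (deriv (deriv A) 0 • X + deriv (deriv B) 0 • Y + deriv (deriv C) 0 • Z) := by
  refine curve (c := fun t => A t • X + B t • Y + C t • Z)
    (c1 := fun t => deriv A t • X + deriv B t • Y + deriv C t • Z) hu ?_ ?_
  · filter_upwards [c2_ev hA, c2_ev hB, c2_ev hC] with t h1 h2 h3
    exact ((h1.hasDerivAt.smul_const X).fun_add (h2.hasDerivAt.smul_const Y)).fun_add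
      (h3.hasDerivAt.smul_const Z)
  · exact (((c2_d hA).hasDerivAt.smul_const X).fun_add ((c2_d hB).hasDerivAt.smul_const Y)).fun_add
      ((c2_d hC).hasDerivAt.smul_const Z)

/-- the inversion -/
noncomputable def Kv {n : ℕ} (s : ℝ) (z : EE n) : EE n :=
  ((s / rh z) • z.1, s ^ 2 * z.2 / rh z ^ 2)

theorem zp_d (c : ℝ) (p : ℤ) (r : ℝ) (_hr : r ≠ 0) :
    deriv (fun t : ℝ => c * t ^ p) r = c * (p * r ^ (p - 1)) := by
  simp
theorem zp_dd (c : ℝ) (p : ℤ) (r : ℝ) (hr : r ≠ 0) :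
    deriv (deriv (fun t : ℝ => c * t ^ p)) r = c * (p * ((p - 1) * r ^ (p - 2))) := by
  have : deriv (fun t : ℝ => c * t ^ p) = fun t => (c * p) * t ^ (p - 1) := by
    funext t; simp; ring
  rw [this, zp_d _ _ _ hr]
  push_cast
  ring_nf
theorem zp_c2 (c : ℝ) (p : ℤ) (r : ℝ) (hr : r ≠ 0) : ContDiffAt ℝ 2 (fun t : ℝ => c * t ^ p) r := by
  refine contDiffAt_const.mul ?_
  cases p with
  | ofNat k => simpa using contDiffAt_id.pow k
  | negSucc k =>
    simp only [zpow_negSucc]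
    exact ContDiffAt.inv (f := fun t : ℝ => t ^ (k + 1)) (by fun_prop) (by simpa using hr)

/-- composite with quadratic -/
theorem zq (c : ℝ) (p : ℤ) (r b q : ℝ) (hr : r ≠ 0) :
   ContDiffAt ℝ 2 (fun t : ℝ => c * (r + 2 * t * b + q * t ^ 2) ^ p) 0 ∧
   deriv (fun t : ℝ => c * (r + 2 * t * b + q * t ^ 2) ^ p) 0 = c * (p * r ^ (p - 1)) * (2 * b) ∧
   deriv (deriv (fun t : ℝ => c * (r + 2 * t * b + q * t ^ 2) ^ p)) 0 =
     c * (p * ((p - 1) * r ^ (p - 2))) * (2 * b) ^ 2 + c * (p * r ^ (p - 1)) * (2 * q) := by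
  have hg : ContDiffAt ℝ 2 (fun t : ℝ => r + 2 * t * b + q * t ^ 2) 0 := by fun_prop
  have h0 : (fun t : ℝ => r + 2 * t * b + q * t ^ 2) 0 = r := by simp
  have h0' : r + 2 * 0 * b + q * 0 ^ 2 = r := by simp
  have hk : ContDiffAt ℝ 2 (fun t : ℝ => c * t ^ p) ((fun t : ℝ => r + 2 * t * b + q * t ^ 2) 0) := by
    rw [h0]; exact zp_c2 c p r hr
  refine ⟨ContDiffAt.comp (g := fun t : ℝ => c * t ^ p) 0 hk hg, ?_, ?_⟩
  · have := deriv_comp (h₂ := fun t : ℝ => c * t ^ p) (0:ℝ) (hk.differentiableAt (by norm_num))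
      (hg.differentiableAt (by norm_num))
    simp only [Function.comp_def] at this
    rw [this, quad_d, h0', zp_d _ _ _ hr]; simp
  · rw [dd_comp (k := fun t : ℝ => c * t ^ p) hg hk, quad_dd, quad_d, h0', zp_d _ _ _ hr, zp_dd _ _ _ hr]
    simp

theorem LF_frechet {u : EE n → ℝ} {w : EE n} (hu : ContDiffAt ℝ 2 u w) :
    LF a u w = w.2 * fderiv ℝ (fderiv ℝ u) w ey ey + a * fderiv ℝ u w ey
      + ∑ i, fderiv ℝ (fderiv ℝ u) w (ex i) (ex i) := by
  have key : ∀ v : EE n, D1 u w v = fderiv ℝ u w v ∧ D2 u w v = fderiv ℝ (fderiv ℝ u) w v v := by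
    intro v
    have := curve (u := u) (c := fun t : ℝ => w + t • v) (c1 := fun _ => v) (c2 := 0) (by simpa using hu)
      (Eventually.of_forall fun t => by simpa using ((hasDerivAt_id' t).smul_const v).const_add w)
      (hasDerivAt_const _ _)
    simpa [D1, D2] using this
  simp only [LF, (key _).1, (key _).2]

end kelvin

open Set Filter Topology

section kelvin2
variable {n : ℕ} {a : ℝ}

theorem Kv_ex (s : ℝ) (z : EE n) (t : ℝ) (i : Fin n) :
    Kv s (z + t • ex i) = (s * (rh z + 2 * t * z.1 i + 1 * t ^ 2) ^ (-1 : ℤ)) • ((z.1, 0) : EE n)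
      + ((s * (rh z + 2 * t * z.1 i + 1 * t ^ 2) ^ (-1 : ℤ)) * t) • ex i
      + (s ^ 2 * z.2 * (rh z + 2 * t * z.1 i + 1 * t ^ 2) ^ (-2 : ℤ)) • ey := by
  simp only [Kv, rh_ex, one_mul, zpow_neg, zpow_one]
  have h2 : ∀ r : ℝ, r ^ (2:ℤ) = r ^ 2 := fun r => by norm_cast
  ext j
  · simp [ex, ey]; ring
  · simp [ex, ey, h2]; ring

theorem Kv_ey (s : ℝ) (z : EE n) (t : ℝ) :
    Kv s (z + t • ey) = (s * (rh z + 2 * t * 2 + 0 * t ^ 2) ^ (-1 : ℤ)) • ((z.1, 0) : EE n)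
      + (0 : ℝ) • ey
      + ((s ^ 2 * (rh z + 2 * t * 2 + 0 * t ^ 2) ^ (-2 : ℤ)) * (z.2 + 1 * t)) • ey := by
  simp only [Kv, rh_ey, one_mul, zpow_neg, zpow_one]
  have h2 : ∀ r : ℝ, r ^ (2:ℤ) = r ^ 2 := fun r => by norm_cast
  have h3 : rh z + 2 * t * 2 + 0 * t ^ 2 = rh z + 4 * t := by ring
  rw [h3]
  ext j
  · simp [ey]; ring_nf; simp
  · simp [ey, h2]; ring

theorem lin_d (A B : ℝ) : ContDiffAt ℝ 2 (fun t : ℝ => A + B * t) 0 ∧ deriv (fun t : ℝ => A + B * t) 0 = B ∧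
    deriv (deriv (fun t : ℝ => A + B * t)) 0 = 0 := by
  have : deriv (fun t : ℝ => A + B * t) = fun _ => B := by funext t; simp
  refine ⟨by fun_prop, by rw [this], by rw [this]; simp⟩

theorem D_Kv_ex {u : EE n → ℝ} (s : ℝ) (z : EE n) (hz : rh z ≠ 0) (hu : ContDiffAt ℝ 2 u (Kv s z)) (i : Fin n) 
   (k1 k2 : EE n) 
   (hk1 : k1 = (-(2 * s * z.1 i) / rh z ^ 2) • ((z.1, 0) : EE n) + (s / rh z) • ex i +
      (-(4 * s ^ 2 * z.2 * z.1 i) / rh z ^ 3) • ey)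
   (hk2 : k2 = (8 * s * z.1 i ^ 2 / rh z ^ 3 - 2 * s / rh z ^ 2) • ((z.1, 0) : EE n)
      + (-(4 * s * z.1 i) / rh z ^ 2) • ex i +
      (24 * s ^ 2 * z.2 * z.1 i ^ 2 / rh z ^ 4 - 4 * s ^ 2 * z.2 / rh z ^ 3) • ey) :
    D1 (fun w => u (Kv s w)) z (ex i) = fderiv ℝ u (Kv s z) k1 ∧
    D2 (fun w => u (Kv s w)) z (ex i) = fderiv ℝ (fderiv ℝ u) (Kv s z) k1 k1 + fderiv ℝ u (Kv s z) k2 := by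
  obtain ⟨A0, A1, A2⟩ := zq s (-1) (rh z) (z.1 i) 1 hz
  obtain ⟨C0, C1, C2⟩ := zq (s ^ 2 * z.2) (-2) (rh z) (z.1 i) 1 hz
  have hid : ContDiffAt ℝ 2 (fun t : ℝ => t) 0 := by fun_prop
  have B0 := A0.mul hid
  have B1 := deriv_fun_mul (A0.differentiableAt (by norm_num)) (hid.differentiableAt (by norm_num))
  have B2 := dd_mul A0 hid
  have hK : Kv s z = (s * (rh z + 2 * 0 * z.1 i + 1 * 0 ^ 2) ^ (-1 : ℤ)) • ((z.1, 0) : EE n)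
      + ((s * (rh z + 2 * 0 * z.1 i + 1 * 0 ^ 2) ^ (-1 : ℤ)) * 0) • ex i
      + (s ^ 2 * z.2 * (rh z + 2 * 0 * z.1 i + 1 * 0 ^ 2) ^ (-2 : ℤ)) • ey := by
    rw [← Kv_ex]; simp
  have key := curve3 (u := u) ((z.1, 0) : EE n) (ex i) ey A0 B0 C0 (by rw [← hK]; exact hu)
  simp only [D1, D2, Kv_ex]
  rw [← hK] at key
  have z1 : rh z ^ ((-1:ℤ) - 1) = (rh z ^ 2)⁻¹ := by rw [show ((-1:ℤ) - 1) = -((2:ℕ):ℤ) by norm_num, zpow_neg, zpow_natCast]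
  have z2 : rh z ^ ((-1:ℤ) - 2) = (rh z ^ 3)⁻¹ := by rw [show ((-1:ℤ) - 2) = -((3:ℕ):ℤ) by norm_num, zpow_neg, zpow_natCast]
  have z3 : rh z ^ ((-2:ℤ) - 1) = (rh z ^ 3)⁻¹ := by rw [show ((-2:ℤ) - 1) = -((3:ℕ):ℤ) by norm_num, zpow_neg, zpow_natCast]
  have z4 : rh z ^ ((-2:ℤ) - 2) = (rh z ^ 4)⁻¹ := by rw [show ((-2:ℤ) - 2) = -((4:ℕ):ℤ) by norm_num, zpow_neg, zpow_natCast]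
  have hid1 : deriv (fun t : ℝ => t) = fun _ => 1 := by funext t; simp
  have h00 : (rh z + 2 * 0 * z.1 i + 1 * 0 ^ 2) = rh z := by ring
  have A1' : deriv (fun t : ℝ => s * (rh z + 2 * t * z.1 i + 1 * t ^ 2) ^ (-1 : ℤ)) 0
      = -(2 * s * z.1 i) / rh z ^ 2 := by rw [A1, z1]; push_cast; ring
  have C1' : deriv (fun t : ℝ => s ^ 2 * z.2 * (rh z + 2 * t * z.1 i + 1 * t ^ 2) ^ (-2 : ℤ)) 0
      = -(4 * s ^ 2 * z.2 * z.1 i) / rh z ^ 3 := by rw [C1, z3]; push_cast; ring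
  rw [hid1, h00, zpow_neg_one] at B1 B2
  have B1' := B1.trans (show _ = s / rh z by ring)
  rw [A1'] at B2
  have B2' := B2.trans (show _ = -(4 * s * z.1 i) / rh z ^ 2 by simp; ring)
  have A2' := A2.trans (show _ = 8 * s * z.1 i ^ 2 / rh z ^ 3 - 2 * s / rh z ^ 2 by
    rw [z1, z2]; push_cast; ring)
  have C2' := C2.trans (show _ = 24 * s ^ 2 * z.2 * z.1 i ^ 2 / rh z ^ 4 - 4 * s ^ 2 * z.2 / rh z ^ 3 by
    rw [z3, z4]; push_cast; ring)
  rw [A2', B2', C2', A1', B1', C1', ← hk1, ← hk2] at key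
  exact key

theorem D_Kv_ey {u : EE n → ℝ} (s : ℝ) (z : EE n) (hz : rh z ≠ 0) (hu : ContDiffAt ℝ 2 u (Kv s z))
   (k1 k2 : EE n) 
   (hk1 : k1 = (-(4 * s) / rh z ^ 2) • ((z.1, 0) : EE n) + 
      (s ^ 2 / rh z ^ 2 - 8 * s ^ 2 * z.2 / rh z ^ 3) • ey)
   (hk2 : k2 = (32 * s / rh z ^ 3) • ((z.1, 0) : EE n)
      + (- 16 * s ^ 2 / rh z ^ 3 + 96 * s ^ 2 * z.2 / rh z ^ 4) • ey) :
    D1 (fun w => u (Kv s w)) z ey = fderiv ℝ u (Kv s z) k1 ∧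
    D2 (fun w => u (Kv s w)) z ey = fderiv ℝ (fderiv ℝ u) (Kv s z) k1 k1 + fderiv ℝ u (Kv s z) k2 := by
  obtain ⟨A0, A1, A2⟩ := zq s (-1) (rh z) 2 0 hz
  obtain ⟨C0, C1, C2⟩ := zq (s ^ 2) (-2) (rh z) 2 0 hz
  obtain ⟨l0, l1, l2⟩ := lin_d z.2 1
  have B0 := C0.mul l0
  have B1 := deriv_fun_mul (C0.differentiableAt (by norm_num)) (l0.differentiableAt (by norm_num))
  have B2 := dd_mul C0 l0
  have hK : Kv s z = (s * (rh z + 2 * 0 * 2 + 0 * 0 ^ 2) ^ (-1 : ℤ)) • ((z.1, 0) : EE n)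
      + (0 : ℝ) • ey
      + ((s ^ 2 * (rh z + 2 * 0 * 2 + 0 * 0 ^ 2) ^ (-2 : ℤ)) * (z.2 + 1 * 0)) • ey := by
    rw [← Kv_ey]; simp
  have key := curve3 (u := u) (B := fun _ => 0) ((z.1, 0) : EE n) ey ey A0 contDiffAt_const B0 (by rw [← hK]; exact hu)
  simp only [D1, D2, Kv_ey]
  rw [← hK] at key
  have z1 : rh z ^ ((-1:ℤ) - 1) = (rh z ^ 2)⁻¹ := by rw [show ((-1:ℤ) - 1) = -((2:ℕ):ℤ) by norm_num, zpow_neg, zpow_natCast]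
  have z2 : rh z ^ ((-1:ℤ) - 2) = (rh z ^ 3)⁻¹ := by rw [show ((-1:ℤ) - 2) = -((3:ℕ):ℤ) by norm_num, zpow_neg, zpow_natCast]
  have z3 : rh z ^ ((-2:ℤ) - 1) = (rh z ^ 3)⁻¹ := by rw [show ((-2:ℤ) - 1) = -((3:ℕ):ℤ) by norm_num, zpow_neg, zpow_natCast]
  have z4 : rh z ^ ((-2:ℤ) - 2) = (rh z ^ 4)⁻¹ := by rw [show ((-2:ℤ) - 2) = -((4:ℕ):ℤ) by norm_num, zpow_neg, zpow_natCast]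
  have z5 : rh z ^ (-2:ℤ) = (rh z ^ 2)⁻¹ := by rw [show (-2:ℤ) = -((2:ℕ):ℤ) by norm_num, zpow_neg, zpow_natCast]
  have h00 : (rh z + 2 * 0 * 2 + 0 * 0 ^ 2) = rh z := by ring
  have hd0 : deriv (fun _ : ℝ => (0:ℝ)) = fun _ => 0 := by funext t; simp
  have A1' := A1.trans (show _ = -(4 * s) / rh z ^ 2 by rw [z1]; push_cast; ring)
  have A2' := A2.trans (show _ = 32 * s / rh z ^ 3 by rw [z1, z2]; push_cast; ring)
  rw [h00, z5, l1, C1, z3] at B1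
  have B1' := B1.trans (show _ = s ^ 2 / rh z ^ 2 - 8 * s ^ 2 * z.2 / rh z ^ 3 by push_cast; ring)
  rw [h00, z5, l1, l2, C2, C1, z3, z4] at B2
  have B2' := B2.trans (show _ = - 16 * s ^ 2 / rh z ^ 3 + 96 * s ^ 2 * z.2 / rh z ^ 4 by push_cast; ring)
  rw [A2', B2', A1', B1'] at key
  simp only [hd0, zero_smul, add_zero] at key
  rw [← hk1, ← hk2] at key
  simp only [zero_smul, add_zero]
  exact key

end kelvin2

open Set Filter Topology

section kelvin3
variable {n : ℕ} {a : ℝ}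

theorem Kv_c2 (s : ℝ) (z : EE n) (hz : rh z ≠ 0) : ContDiffAt ℝ 2 (Kv (n := n) s) z := by
  have h := rh_c2.contDiffAt (x := z)
  unfold Kv
  refine ContDiffAt.prodMk ?_ ?_
  · exact (contDiffAt_const.div h hz).smul contDiff_fst.contDiffAt
  · exact (contDiffAt_const.mul contDiff_snd.contDiffAt).div (h.pow 2) (pow_ne_zero 2 hz)

theorem x_decomp (x : Fin n → ℝ) : ((x, 0) : EE n) = ∑ i, x i • ex i := by
  ext j
  · simp [ex, Prod.fst_sum, Finset.sum_apply, Pi.single_apply]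
  · simp [ex, Prod.snd_sum]

theorem LF_kelvin {u : EE n → ℝ} (s c m : ℝ) (z : EE n) (hz : 0 < rh z) (hm : m = n / 2 + a - 1)
    (hu : ContDiffAt ℝ 2 u (Kv s z)) :
    LF a (fun w => c * rh w ^ (-m) * u (Kv s w)) z
      = c * rh z ^ (-m) * (s / rh z) ^ 2 * LF a u (Kv s z) := by
  have hz' := hz.ne'
  have hf : ContDiffAt ℝ 2 (fun w : EE n => c * rh w ^ (-m)) z :=
    ContDiffAt.comp (g := fun t => c * t ^ (-m)) z (pow_c2 _ _ _ hz) rh_c2.contDiffAt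
  have hv : ContDiffAt ℝ 2 (fun w : EE n => u (Kv s w)) z :=
    ContDiffAt.comp (g := u) z hu (Kv_c2 s z hz')
  rw [LF_mul hf hv, LF_fund z hz c m hm, LF_frechet hu]
  have hD1 : ∀ v, D1 (fun w : EE n => c * rh w ^ (-m)) z v = c * rh z ^ (-m) * (-m / rh z) * D1 rh z v := by
    intro v
    rw [D1_comp (k := fun t => c * t ^ (-m)) rh_c2.contDiffAt (pow_c2 _ _ _ hz), pow_d _ _ _ hz]
    rw [Real.rpow_sub_one hz']; ring
  set f := c * rh z ^ (-m) with hfdef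
  set l := fderiv ℝ u (Kv s z) with hl
  set Q := fderiv ℝ (fderiv ℝ u) (Kv s z) with hQ
  have hsymm : ∀ v w, Q v w = Q w v := by
    have := hu.isSymmSndFDerivAt (by simp)
    intro v w; exact this.eq v w
  have hex := fun i => D_Kv_ex (u := u) s z hz' hu i _ _ rfl rfl
  have hey := D_Kv_ey (u := u) s z hz' hu _ _ rfl rfl
  simp only [← hl, ← hQ] at hex hey
  simp only [GG, LF, hD1, D1_rh_ey, D1_rh_ex, hey.1, hey.2, (hex _).1, (hex _).2]
  set X : EE n := (z.1, 0) with hX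
  set r := rh z with hr
  have hXX : ∑ i, z.1 i ^ 2 = r - 4 * z.2 := by simp [hr, rh, XX]
  have slX : ∑ i, z.1 i * l (ex i) = l X := by
    rw [hX, x_decomp]; simp
  have sQX : ∑ i, z.1 i * Q X (ex i) = Q X X := by
    conv_rhs => rw [hX]; arg 2; rw [x_decomp]
    simp
    rfl
  have sQY : ∑ i, z.1 i * Q ey (ex i) = Q X ey := by
    rw [hsymm X ey, hX, x_decomp]
    simp
  simp only [map_add, map_smul, add_apply, smul_apply, smul_eq_mul]
  simp only [fun i => hsymm (ex i) X, fun i => hsymm (ex i) ey, hsymm ey X]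
  have e1 : ∑ i, (-(2 * s * z.1 i) / r ^ 2 *
        (-(2 * s * z.1 i) / r ^ 2 * Q X X + s / r * Q X (ex i) + -(4 * s ^ 2 * z.2 * z.1 i) / r ^ 3 * Q X ey) +
      s / r * (-(2 * s * z.1 i) / r ^ 2 * Q X (ex i) + s / r * Q (ex i) (ex i) + -(4 * s ^ 2 * z.2 * z.1 i) / r ^ 3 * Q ey (ex i)) + 
      -(4 * s ^ 2 * z.2 * z.1 i) / r ^ 3 * (-(2 * s * z.1 i) / r ^ 2 * Q X ey + s / r * Q ey (ex i) + -(4 * s ^ 2 * z.2 * z.1 i) / r ^ 3 * Q ey ey) +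
      ((8 * s * z.1 i ^ 2 / r ^ 3 - 2 * s / r ^ 2) * l X + -(4 * s * z.1 i) / r ^ 2 * l (ex i) +
        (24 * s ^ 2 * z.2 * z.1 i ^ 2 / r ^ 4 - 4 * s ^ 2 * z.2 / r ^ 3) * l ey))
     = (4 * s ^ 2 / r ^ 4 * Q X X + 16 * s ^ 3 * z.2 / r ^ 5 * Q X ey + 16 * s ^ 4 * z.2 ^ 2 / r ^ 6 * Q ey ey
         + 8 * s / r ^ 3 * l X + 24 * s ^ 2 * z.2 / r ^ 4 * l ey) * (r - 4 * z.2)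
       + (-4 * s ^ 2 / r ^ 3) * Q X X + (-8 * s ^ 3 * z.2 / r ^ 4) * Q X ey + s ^ 2 / r ^ 2 * ∑ i, Q (ex i) (ex i)
       - n * (2 * s / r ^ 2 * l X + 4 * s ^ 2 * z.2 / r ^ 3 * l ey) - 4 * s / r ^ 2 * l X := by
    have pt : ∀ i, (-(2 * s * z.1 i) / r ^ 2 *
        (-(2 * s * z.1 i) / r ^ 2 * Q X X + s / r * Q X (ex i) + -(4 * s ^ 2 * z.2 * z.1 i) / r ^ 3 * Q X ey) +
      s / r * (-(2 * s * z.1 i) / r ^ 2 * Q X (ex i) + s / r * Q (ex i) (ex i) + -(4 * s ^ 2 * z.2 * z.1 i) / r ^ 3 * Q ey (ex i)) +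
      -(4 * s ^ 2 * z.2 * z.1 i) / r ^ 3 * (-(2 * s * z.1 i) / r ^ 2 * Q X ey + s / r * Q ey (ex i) + -(4 * s ^ 2 * z.2 * z.1 i) / r ^ 3 * Q ey ey) +
      ((8 * s * z.1 i ^ 2 / r ^ 3 - 2 * s / r ^ 2) * l X + -(4 * s * z.1 i) / r ^ 2 * l (ex i) +
        (24 * s ^ 2 * z.2 * z.1 i ^ 2 / r ^ 4 - 4 * s ^ 2 * z.2 / r ^ 3) * l ey))
      = (4 * s ^ 2 / r ^ 4 * Q X X + 16 * s ^ 3 * z.2 / r ^ 5 * Q X ey + 16 * s ^ 4 * z.2 ^ 2 / r ^ 6 * Q ey ey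
         + 8 * s / r ^ 3 * l X + 24 * s ^ 2 * z.2 / r ^ 4 * l ey) * z.1 i ^ 2
       + (-4 * s ^ 2 / r ^ 3) * (z.1 i * Q X (ex i)) + (-8 * s ^ 3 * z.2 / r ^ 4) * (z.1 i * Q ey (ex i))
       + s ^ 2 / r ^ 2 * Q (ex i) (ex i)
       + (-(2 * s / r ^ 2 * l X + 4 * s ^ 2 * z.2 / r ^ 3 * l ey)) + (- 4 * s / r ^ 2) * (z.1 i * l (ex i)) := by
      intro i
      ring
    simp only [pt, Finset.sum_add_distrib, ← Finset.mul_sum, hXX, slX, sQX, sQY, Finset.sum_const,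
      Finset.card_univ, Fintype.card_fin, nsmul_eq_mul]
    ring
  rw [e1]
  have e2 : ∑ i, f * (-m / r) * (2 * z.1 i) * (-(2 * s * z.1 i) / r ^ 2 * l X + s / r * l (ex i)
        + -(4 * s ^ 2 * z.2 * z.1 i) / r ^ 3 * l ey)
      = (f * (-m / r) * 2) * ((-(2 * s) / r ^ 2 * l X - 4 * s ^ 2 * z.2 / r ^ 3 * l ey) * (r - 4 * z.2)
         + s / r * l X) := by
    have pt : ∀ i, f * (-m / r) * (2 * z.1 i) * (-(2 * s * z.1 i) / r ^ 2 * l X + s / r * l (ex i)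
        + -(4 * s ^ 2 * z.2 * z.1 i) / r ^ 3 * l ey)
      = (f * (-m / r) * 2) * (-(2 * s) / r ^ 2 * l X - 4 * s ^ 2 * z.2 / r ^ 3 * l ey) * z.1 i ^ 2
        + (f * (-m / r) * 2) * (s / r) * (z.1 i * l (ex i)) := by
      intro i; ring
    simp only [pt, Finset.sum_add_distrib, ← Finset.mul_sum, hXX, slX]
    ring
  rw [e2]
  have hK : (Kv s z).2 = s ^ 2 * z.2 / r ^ 2 := rfl
  rw [hK]
  have hr0 : r ≠ 0 := hz'
  have hmn : (n : ℝ) = 2 * m - 2 * a + 2 := by rw [hm]; ring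
  rw [hmn]
  field_simp
  ring

end kelvin3

open Set Filter Topology

section mp
variable {n : ℕ} {a : ℝ}

theorem XX_nonneg (p : Fin n → ℝ) (z : EE n) : 0 ≤ XX p z := Finset.sum_nonneg fun _ _ => sq_nonneg _

theorem rh_nonneg {z : EE n} (hz : 0 ≤ z.2) : 0 ≤ rh z := by
  have := XX_nonneg 0 z
  unfold rh; linarith

theorem rh_pos {z : EE n} (hz : 0 < z.2) : 0 < rh z := by
  have := XX_nonneg 0 z
  unfold rh; linarith

theorem rh_cont : Continuous (rh (n := n)) := rh_c2.continuous

theorem XX_cont (p : Fin n → ℝ) : Continuous (XX p) := (XX_c2 p).continuous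

theorem compact_aux (p : Fin n → ℝ) (R S : ℝ) : IsCompact {z : EE n | 0 ≤ z.2 ∧ z.2 ≤ S ∧ XX p z ≤ R} := by
  have hK : IsCompact ((Set.pi univ fun i => Icc (p i - (R+1)) (p i + (R+1))) ×ˢ Icc (0:ℝ) S) :=
    (isCompact_univ_pi fun i => isCompact_Icc).prod isCompact_Icc
  refine hK.of_isClosed_subset ?_ ?_
  · exact (isClosed_le continuous_const continuous_snd).inter
      ((isClosed_le continuous_snd continuous_const).inter (isClosed_le (XX_cont p) continuous_const))
  · rintro z ⟨h1, h2, h3⟩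
    refine ⟨?_, h1, h2⟩
    intro i _
    have : (z.1 i - p i) ^ 2 ≤ XX p z :=
      Finset.single_le_sum (f := fun i => (z.1 i - p i) ^ 2) (fun _ _ => sq_nonneg _) (Finset.mem_univ i)
    constructor <;> nlinarith

theorem compact_rh (R : ℝ) : IsCompact {z : EE n | 0 ≤ z.2 ∧ rh z ≤ R} := by
  refine (compact_aux (n := n) 0 R R).of_isClosed_subset ?_ ?_
  · exact (isClosed_le continuous_const continuous_snd).inter (isClosed_le rh_cont continuous_const)
  · rintro z ⟨h1, h2⟩
    have := XX_nonneg 0 z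
    unfold rh at h2
    refine ⟨h1, by linarith, by linarith⟩

theorem compact_ann (r R : ℝ) : IsCompact {z : EE n | 0 ≤ z.2 ∧ r ≤ rh z ∧ rh z ≤ R} := by
  refine (compact_rh (n := n) R).of_isClosed_subset ?_ ?_
  · exact (isClosed_le continuous_const continuous_snd).inter
      ((isClosed_le continuous_const rh_cont).inter (isClosed_le rh_cont continuous_const))
  · rintro z ⟨h1, h2, h3⟩
    exact ⟨h1, h3⟩

/-- closure helper -/
theorem closure_nonneg {f : EE n → ℝ} {S : Set (EE n)} {z : EE n} (hc : ContinuousWithinAt f S z)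
    {η : ℝ} (hη : 0 < η) (hS : ∀ t, 0 < t → t < η → z + t • ey ∈ S)
    (hf : ∀ t, 0 < t → t < η → 0 ≤ f (z + t • ey)) : 0 ≤ f z := by
  have h1 : Tendsto (fun t : ℝ => z + t • (ey : EE n)) (𝓝[>] 0) (𝓝[S] z) := by
    refine tendsto_nhdsWithin_iff.2 ⟨?_, ?_⟩
    · have : ContinuousAt (fun t : ℝ => z + t • (ey : EE n)) 0 := by fun_prop
      have h := this.tendsto
      simp only [zero_smul, add_zero] at h
      exact h.mono_left nhdsWithin_le_nhds
    · filter_upwards [Ioo_mem_nhdsGT hη] with t ht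
      exact hS t ht.1 ht.2
  have h2 := hc.tendsto.comp h1
  refine ge_of_tendsto h2 ?_
  filter_upwards [Ioo_mem_nhdsGT hη] with t ht
  exact hf t ht.1 ht.2

theorem LF_ypow (z : EE n) (hz : 0 < z.2) (ε b : ℝ) (hb : b = (a - 1) / 2) :
    LF a (fun w => ε * w.2 ^ (-b)) z = - ε * b ^ 2 * z.2 ^ (-b - 1) := by
  rw [LF_comp (f := fun w : EE n => w.2) (k := fun t => ε * t ^ (-b)) y_c2.contDiffAt (pow_c2 _ _ _ hz),
    pow_d _ _ _ hz, pow_dd _ _ _ hz, LF_y, GG_y]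
  have : z.2 ^ (-b - 1) = z.2 ^ (-b - 2) * z.2 := by
    rw [← Real.rpow_add_one hz.ne']; ring_nf
  rw [this, hb]; ring

theorem MP (ha : 1 < a) {D : Set (EE n)} (hD : IsCompact D) {C A : ℝ}
    (hC : 0 ≤ C) (hA : ∀ z ∈ D, rh z < A ∧ C * (A - rh z) < 2 * n + 4 * a) {w : EE n → ℝ}
    (hw : ContinuousOn w D)
    (hLF : ∀ z ∈ D, 0 < z.2 → w z < 0 → D ∈ 𝓝 z ∧ ContDiffAt ℝ 2 w z ∧ LF a w z ≤ -C * w z) :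
    ∀ z ∈ D, 0 < z.2 → 0 ≤ w z := by
  intro z1 hz1 hz1p
  by_contra hneg
  push Not at hneg
  obtain ⟨b, hb⟩ : ∃ b, b = (a - 1) / 2 := ⟨_, rfl⟩
  have hb0 : 0 < b := by rw [hb]; linarith
  -- d
  obtain ⟨d, hd, hdD⟩ : ∃ d > 0, ∀ z ∈ D, C * (A - rh z) ≤ 2 * n + 4 * a - d := by
    obtain ⟨z2, hz2, hmax⟩ := hD.exists_isMaxOn ⟨z1, hz1⟩
      (f := fun z => C * (A - rh z)) (by have := rh_cont (n := n); fun_prop)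
    refine ⟨2 * n + 4 * a - C * (A - rh z2), by linarith [(hA z2 hz2).2], fun z hz => ?_⟩
    have : C * (A - rh z) ≤ C * (A - rh z2) := hmax hz
    linarith
  obtain ⟨M, hM, hMD⟩ : ∃ M > 0, ∀ z ∈ D, 0 < z.2 → z.2 ^ (-b - 1) * (C * z.2 - b ^ 2) ≤ M := by
    refine ⟨|(b ^ 2 / C) ^ (-b - 1) * (C * A)| + 1, by positivity, fun z hz hzp => ?_⟩
    have hp : 0 < z.2 ^ (-b - 1) := Real.rpow_pos_of_pos hzp _
    rcases le_or_gt (C * z.2) (b ^ 2) with h | h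
    · have : z.2 ^ (-b - 1) * (C * z.2 - b ^ 2) ≤ 0 := mul_nonpos_of_nonneg_of_nonpos hp.le (by linarith)
      linarith [abs_nonneg ((b ^ 2 / C) ^ (-b - 1) * (C * A))]
    · have hC0 : 0 < C := by
        rcases hC.lt_or_eq with h' | h'
        · exact h'
        · rw [← h', zero_mul] at h; nlinarith
      have hy : b ^ 2 / C ≤ z.2 := by rw [div_le_iff₀ hC0]; linarith
      have h1 : z.2 ^ (-b - 1) ≤ (b ^ 2 / C) ^ (-b - 1) :=
        Real.rpow_le_rpow_of_nonpos (by positivity) hy (by linarith)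
      have h2 : z.2 ≤ A := by
        have := XX_nonneg 0 z
        have h3 := (hA z hz).1
        unfold rh at h3; linarith
      have h3 : z.2 ^ (-b - 1) * (C * z.2 - b ^ 2) ≤ (b ^ 2 / C) ^ (-b - 1) * (C * A) := by
        apply mul_le_mul h1 _ (by linarith) (by positivity)
        nlinarith [sq_nonneg b]
      linarith [le_abs_self ((b ^ 2 / C) ^ (-b - 1) * (C * A))]
  obtain ⟨ε, hε⟩ : ∃ ε, ε = d / (2 * M) := ⟨_, rfl⟩
  have hε0 : 0 < ε := by rw [hε]; positivity
  have hεM : ε * M < d := by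
    rw [hε]; field_simp; linarith
  obtain ⟨G, hG⟩ : ∃ G : EE n → ℝ, G = fun z => (A + (-1) * rh z) + ε * z.2 ^ (-b) := ⟨_, rfl⟩
  have hGc : ∀ z : EE n, 0 < z.2 → ContDiffAt ℝ 2 G z := by
    intro z hz
    rw [hG]
    refine (contDiffAt_const.add (contDiffAt_const.mul rh_c2.contDiffAt)).add ?_
    exact ContDiffAt.comp (g := fun t => ε * t ^ (-b)) z (pow_c2 _ _ _ hz) y_c2.contDiffAt
  have hGL : ∀ z ∈ D, 0 < z.2 → LF a G z + C * G z < 0 := by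
    intro z hz hzp
    have e : LF a G z = -(2 * n + 4 * a) + -ε * b ^ 2 * z.2 ^ (-b - 1) := by
      have hc2 : ContDiffAt ℝ 2 (fun w : EE n => ε * w.2 ^ (-b)) z :=
        ContDiffAt.comp (g := fun t => ε * t ^ (-b)) z (pow_c2 _ _ _ hzp) y_c2.contDiffAt
      rw [hG, LF_add (contDiffAt_const.add (contDiffAt_const.mul rh_c2.contDiffAt)) hc2,
        LF_add contDiffAt_const (contDiffAt_const.mul rh_c2.contDiffAt), LF_const, LF_cmul, LF_rh,
        LF_ypow z hzp ε b hb]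
      ring
    have e2 : z.2 ^ (-b) = z.2 ^ (-b - 1) * z.2 := by
      rw [← Real.rpow_add_one hzp.ne']; ring_nf
    rw [e, hG]
    simp only [e2]
    have h1 := hdD z hz
    have h2 := mul_le_mul_of_nonneg_left (hMD z hz hzp) hε0.le
    nlinarith
  have hGpos : ∀ z ∈ D, 0 < z.2 → ε * z.2 ^ (-b) < G z := by
    intro z hz hzp
    have := (hA z hz).1
    rw [hG]; simp only; linarith
  have hGpos' : ∀ z ∈ D, 0 < z.2 → 0 < G z := fun z hz hzp =>
    lt_trans (mul_pos hε0 (Real.rpow_pos_of_pos hzp _)) (hGpos z hz hzp)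
  -- lower bound on w
  obtain ⟨W, hW0, hW⟩ : ∃ W > 0, ∀ z ∈ D, -W ≤ w z := by
    obtain ⟨z2, hz2, hmin⟩ := hD.exists_isMinOn ⟨z1, hz1⟩ hw
    refine ⟨|w z2| + 1, by positivity, fun z hz => ?_⟩
    have : w z2 ≤ w z := hmin hz
    linarith [neg_abs_le (w z2)]
  obtain ⟨μ, hμ⟩ : ∃ μ, μ = - w z1 / G z1 := ⟨_, rfl⟩
  have hμ0 : 0 < μ := by rw [hμ]; exact div_pos (by linarith) (hGpos' z1 hz1 hz1p)
  obtain ⟨ys, hys0, hys⟩ : ∃ ys > 0, ∀ y, 0 < y → y < ys → W / (μ * ε) < y ^ (-b) := by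
    have ht := (tendsto_rpow_neg_nhdsGT_zero (y := -b) (by linarith)).eventually_gt_atTop (W / (μ * ε))
    obtain ⟨ys, h1, h2⟩ := mem_nhdsGT_iff_exists_Ioo_subset.1 ht
    exact ⟨ys, h1, fun y hy hy2 => h2 ⟨hy, hy2⟩⟩
  obtain ⟨yt, hyt⟩ : ∃ yt, yt = min ys z1.2 := ⟨_, rfl⟩
  have hyt0 : 0 < yt := by rw [hyt]; exact lt_min hys0 hz1p
  have hD' : IsCompact (D ∩ {z | yt ≤ z.2}) := hD.inter_right (isClosed_le continuous_const continuous_snd)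
  have hz1' : z1 ∈ D ∩ {z | yt ≤ z.2} := ⟨hz1, show yt ≤ z1.2 by rw [hyt]; exact min_le_right _ _⟩
  obtain ⟨z0, hz0, hmin⟩ := hD'.exists_isMinOn ⟨z1, hz1'⟩ (f := fun z => w z / G z) (by
    refine (hw.mono inter_subset_left).div ?_ ?_
    · intro z hz; exact (hGc z (lt_of_lt_of_le hyt0 hz.2)).continuousAt.continuousWithinAt
    · intro z hz; exact (hGpos' z hz.1 (lt_of_lt_of_le hyt0 hz.2)).ne')
  obtain ⟨m, hm⟩ : ∃ m, m = - (w z0 / G z0) := ⟨_, rfl⟩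
  have hmμ : μ ≤ m := by
    have : w z0 / G z0 ≤ w z1 / G z1 := hmin hz1'
    rw [hμ, hm, neg_div]; linarith
  have hz0p : 0 < z0.2 := lt_of_lt_of_le hyt0 hz0.2
  have hall : ∀ z ∈ D, 0 < z.2 → 0 ≤ w z + m * G z := by
    intro z hz hzp
    have hg := hGpos' z hz hzp
    rcases le_or_gt yt z.2 with h | h
    · have h1 : w z0 / G z0 ≤ w z / G z := hmin ⟨hz, h⟩
      have h2 : -m ≤ w z / G z := by rw [hm, neg_neg]; exact h1
      rw [le_div_iff₀ hg] at h2
      linarith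
    · have h1 := hys z.2 hzp (lt_of_lt_of_le h (by rw [hyt]; exact min_le_left _ _))
      rw [div_lt_iff₀ (by positivity)] at h1
      have h2 := hGpos z hz hzp
      have h3 := hW z hz
      nlinarith
  have h0 : w z0 + m * G z0 = 0 := by
    have := (hGpos' z0 hz0.1 hz0p).ne'
    rw [hm]; field_simp; ring
  have hw0 : w z0 < 0 := by
    have := hGpos' z0 hz0.1 hz0p
    nlinarith
  obtain ⟨hn1, hc, hl⟩ := hLF z0 hz0.1 hz0p hw0
  have hloc : IsLocalMin (fun z => w z + m * G z) z0 := by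
    have : ∀ᶠ z : EE n in 𝓝 z0, 0 < z.2 := continuous_snd.continuousAt.eventually (lt_mem_nhds hz0p)
    filter_upwards [hn1, this] with z hz hzp
    simp only [h0]
    exact hall z hz hzp
  have hfin := LF_min (a := a) hz0p (hc.add (contDiffAt_const.mul (hGc z0 hz0p))) hloc
  rw [LF_add hc (contDiffAt_const.mul (hGc z0 hz0p)), LF_cmul] at hfin
  have := hGL z0 hz0.1 hz0p
  have hm0 : 0 < m := lt_of_lt_of_le hμ0 hmμ
  nlinarith

end mp

open Set Filter Topology

section lbbp
variable {n : ℕ} {a : ℝ}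

theorem ypos_nhds {z : EE n} (hz : 0 < z.2) : ∀ᶠ w : EE n in 𝓝 z, 0 < w.2 :=
  continuous_snd.continuousAt.eventually (lt_mem_nhds hz)

theorem LB (ha : 1 < a) {r0 c m : ℝ} (hr0 : 0 < r0) (hc : 0 ≤ c) (hm : m = n / 2 + a - 1) {w : EE n → ℝ}
    (hw : ContinuousOn w {z | 0 ≤ z.2 ∧ r0 ≤ rh z})
    (hw0 : ∀ z : EE n, 0 ≤ z.2 → r0 ≤ rh z → 0 ≤ w z)
    (hLF : ∀ z : EE n, 0 < z.2 → r0 < rh z → ContDiffAt ℝ 2 w z ∧ LF a w z ≤ 0)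
    (hb : ∀ z : EE n, 0 ≤ z.2 → rh z = r0 → c ≤ w z) :
    ∀ z : EE n, 0 ≤ z.2 → r0 ≤ rh z → c * r0 ^ m * rh z ^ (-m) ≤ w z := by
  have hm0 : 0 < m := by
    rw [hm]; have : (0:ℝ) ≤ n := Nat.cast_nonneg n
    linarith
  have hk : 0 ≤ c * r0 ^ m := mul_nonneg hc (Real.rpow_nonneg hr0.le _)
  have hkr : c * r0 ^ m * r0 ^ (-m) = c := by
    rw [mul_assoc, ← Real.rpow_add hr0]; simp
  have hrc : ContinuousOn (fun z : EE n => c * r0 ^ m * rh z ^ (-m)) {z | 0 ≤ z.2 ∧ r0 ≤ rh z} := by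
    refine continuousOn_const.mul (rh_cont.continuousOn.rpow_const ?_)
    intro z hz; left; exact (lt_of_lt_of_le hr0 hz.2).ne'
  have key : ∀ z : EE n, 0 < z.2 → r0 ≤ rh z → c * r0 ^ m * rh z ^ (-m) ≤ w z := by
    intro z hz hzr
    have step : ∀ R, rh z ≤ R → c * r0 ^ m * rh z ^ (-m) - c * r0 ^ m * R ^ (-m) ≤ w z := by
      intro R hR
      have := MP (n := n) (a := a) ha (compact_ann r0 R) (C := 0) (A := R + 1) le_rfl
        (by
          rintro z ⟨h1, h2, h3⟩
          have : (0:ℝ) ≤ n := Nat.cast_nonneg n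
          constructor
          · linarith
          · rw [zero_mul]; linarith)
        (w := fun z => (w z + c * r0 ^ m * R ^ (-m)) + (-1) * (c * r0 ^ m * rh z ^ (-m)))
        (by
          have hs : {z : EE n | 0 ≤ z.2 ∧ r0 ≤ rh z ∧ rh z ≤ R} ⊆ {z | 0 ≤ z.2 ∧ r0 ≤ rh z} :=
            fun z hz => ⟨hz.1, hz.2.1⟩
          exact ((hw.mono hs).add continuousOn_const).add (continuousOn_const.mul (hrc.mono hs)))
        (by
          rintro z ⟨h1, h2, h3⟩ hzp hneg
          have hz0 := hw0 z h1 h2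
          have hRp : 0 < R := by linarith
          have hRm : 0 ≤ c * r0 ^ m * R ^ (-m) := mul_nonneg hk (Real.rpow_nonneg hRp.le _)
          have h4 : r0 < rh z := by
            refine lt_of_le_of_ne h2 fun h => ?_
            have := hb z h1 h.symm
            rw [← h, hkr] at hneg
            linarith
          have h5 : rh z < R := by
            refine lt_of_le_of_ne h3 fun h => ?_
            rw [h] at hneg
            linarith
          have hrp : 0 < rh z := by linarith
          obtain ⟨hc2, hl⟩ := hLF z hzp h4
          have hcf : ContDiffAt ℝ 2 (fun w : EE n => c * r0 ^ m * rh w ^ (-m)) z :=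
            ContDiffAt.comp (g := fun t => c * r0 ^ m * t ^ (-m)) z (pow_c2 _ _ _ hrp) rh_c2.contDiffAt
          refine ⟨?_, (hc2.add contDiffAt_const).add (contDiffAt_const.mul hcf), ?_⟩
          · filter_upwards [ypos_nhds hzp, rh_cont.continuousAt.eventually (lt_mem_nhds h4),
              rh_cont.continuousAt.eventually (gt_mem_nhds h5)] with v e1 e2 e3
            exact ⟨e1.le, e2.le, e3.le⟩
          · rw [LF_add (hc2.add contDiffAt_const) (contDiffAt_const.mul hcf), LF_add hc2 contDiffAt_const,
              LF_const, LF_cmul, LF_fund z hrp _ m hm]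
            simp; exact hl)
        z ⟨hz.le, hzr, hR⟩ hz
      linarith
    have ht : Tendsto (fun R : ℝ => c * r0 ^ m * rh z ^ (-m) - c * r0 ^ m * R ^ (-m)) atTop
        (𝓝 (c * r0 ^ m * rh z ^ (-m) - c * r0 ^ m * 0)) :=
      tendsto_const_nhds.sub (tendsto_const_nhds.mul (tendsto_rpow_neg_atTop hm0))
    rw [mul_zero, sub_zero] at ht
    exact le_of_tendsto ht (by filter_upwards [eventually_ge_atTop (rh z)] with R hR using step R hR)
  intro z hz hzr
  have := closure_nonneg (f := fun z => w z - c * r0 ^ m * rh z ^ (-m)) (z := z)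
    ((hw.sub hrc) z ⟨hz, hzr⟩) (η := 1) one_pos
    (by
      intro t ht _
      refine ⟨?_, ?_⟩
      · rw [y_ey]; linarith
      · rw [rh_ey]; linarith)
    (by
      intro t ht _
      have := key (z + t • ey) (by rw [y_ey]; linarith) (by rw [rh_ey]; linarith)
      simpa using this)
  simpa using this

theorem BP (ha : 1 < a) {x1 : Fin n → ℝ} {η y1 : ℝ} (hη : 0 < η) (hy1 : 0 < y1) {w : EE n → ℝ}
    (hw : ContinuousOn w {z | 0 ≤ z.2 ∧ z.2 ≤ y1 ∧ XX x1 z ≤ η})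
    (hw0 : ∀ z : EE n, 0 ≤ z.2 → z.2 ≤ y1 → XX x1 z ≤ η → 0 ≤ w z)
    (hLF : ∀ z : EE n, 0 < z.2 → z.2 < y1 → XX x1 z < η → ContDiffAt ℝ 2 w z ∧ LF a w z ≤ 0)
    (htop : ∀ z : EE n, z.2 = y1 → XX x1 z ≤ η → 0 < w z) : 0 < w (x1, 0) := by
  have hn0 : (0:ℝ) ≤ n := Nat.cast_nonneg n
  have hXx : ∀ y, XX x1 (x1, y) = 0 := by intro y; simp [XX]
  have hD := compact_aux x1 η y1
  obtain ⟨c1, hc1, htop1⟩ : ∃ c1 > 0, ∀ z : EE n, z.2 = y1 → XX x1 z ≤ η → c1 ≤ w z := by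
    have hT : IsCompact ({z : EE n | 0 ≤ z.2 ∧ z.2 ≤ y1 ∧ XX x1 z ≤ η} ∩ {z | z.2 = y1}) :=
      hD.inter_right (isClosed_eq continuous_snd continuous_const)
    obtain ⟨z2, hz2, hmin⟩ := hT.exists_isMinOn
      ⟨(x1, y1), ⟨hy1.le, le_rfl, by rw [hXx]; exact hη.le⟩, rfl⟩ (hw.mono inter_subset_left)
    refine ⟨w z2, htop z2 hz2.2 hz2.1.2.2, fun z hz hz2 => hmin ⟨⟨?_, ?_, hz2⟩, hz⟩⟩
    · rw [hz]; exact hy1.le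
    · rw [hz]
  obtain ⟨K, hK⟩ : ∃ K, K = (8 + 4 * n) ^ 2 / (32 * η) + 1 := ⟨_, rfl⟩
  have hK0 : 0 < K := by rw [hK]; positivity
  have hKK : (8 + 4 * n) ^ 2 < 32 * η * K := by
    rw [hK]; field_simp; nlinarith
  obtain ⟨κ, hκ⟩ : ∃ κ, κ = c1 / (η ^ 2 * Real.exp (K * y1)) := ⟨_, rfl⟩
  have hκ0 : 0 < κ := by rw [hκ]; positivity
  have hκ1 : κ * (η ^ 2 * Real.exp (K * y1)) = c1 := by rw [hκ]; field_simp
  have hAd : deriv (fun t : ℝ => κ * (η - t) ^ 2) = fun t => -2 * κ * (η - t) := by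
    funext t
    have := (((hasDerivAt_id' t).const_sub η).fun_pow 2).const_mul κ
    rw [this.deriv]; simp; ring
  have hAdd : deriv (deriv (fun t : ℝ => κ * (η - t) ^ 2)) = fun t => 2 * κ := by
    rw [hAd]; funext t
    have := ((hasDerivAt_id' t).const_sub η).const_mul (-2 * κ)
    rw [this.deriv]; ring
  have hBd : deriv (fun t : ℝ => Real.exp (K * t)) = fun t => K * Real.exp (K * t) := by
    funext t
    have := ((hasDerivAt_id' t).const_mul K).exp
    rw [this.deriv]; ring
  have hBdd : deriv (deriv (fun t : ℝ => Real.exp (K * t))) = fun t => K ^ 2 * Real.exp (K * t) := by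
    rw [hBd]; funext t
    have := (((hasDerivAt_id' t).const_mul K).exp).const_mul K
    rw [this.deriv]; ring
  obtain ⟨φ, hφ⟩ : ∃ φ : EE n → ℝ, φ = fun z => (fun t : ℝ => κ * (η - t) ^ 2) (XX x1 z)
      * (fun t : ℝ => Real.exp (K * t)) z.2 := ⟨_, rfl⟩
  have hφc : ContDiff ℝ 2 φ := by
    have := XX_c2 x1
    rw [hφ]; fun_prop
  have hφL : ∀ z : EE n, 0 < z.2 → XX x1 z ≤ η → 0 ≤ LF a φ z := by
    intro z hz hX
    rw [hφ, LF_sep (A := fun t : ℝ => κ * (η - t) ^ 2) (B := fun t : ℝ => Real.exp (K * t)) x1 (by fun_prop) (by fun_prop), hAdd, hAd, hBdd, hBd]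
    simp only
    have hE := Real.exp_pos (K * z.2)
    have e : (4 * XX x1 z * (2 * κ) + 2 * n * (-2 * κ * (η - XX x1 z))) * Real.exp (K * z.2)
       + κ * (η - XX x1 z) ^ 2 * (z.2 * (K ^ 2 * Real.exp (K * z.2)) + a * (K * Real.exp (K * z.2)))
       = κ * Real.exp (K * z.2) * (8 * η - (8 + 4 * n) * (η - XX x1 z) + (η - XX x1 z) ^ 2 * (a * K + z.2 * K ^ 2)) := by
      ring
    rw [e]
    refine mul_nonneg (by positivity) ?_
    set P := η - XX x1 z
    have h1 : P ^ 2 * K ≤ P ^ 2 * (a * K + z.2 * K ^ 2) := by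
      apply mul_le_mul_of_nonneg_left _ (sq_nonneg P)
      have : 0 < z.2 * K ^ 2 := by positivity
      nlinarith
    have h2 : 0 ≤ 8 * η - (8 + 4 * n) * P + P ^ 2 * K := by
      by_contra hlt
      push Not at hlt
      have : 0 ≤ (2 * K * P - (8 + 4 * n)) ^ 2 := sq_nonneg _
      nlinarith
    linarith
  obtain ⟨A, hA⟩ : ∃ A, ∀ z ∈ {z : EE n | 0 ≤ z.2 ∧ z.2 ≤ y1 ∧ XX x1 z ≤ η}, rh z < A := by
    obtain ⟨B, hB⟩ := hD.bddAbove_image rh_cont.continuousOn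
    exact ⟨B + 1, fun z hz => by linarith [hB (mem_image_of_mem rh hz)]⟩
  have hvc : ContinuousOn (fun z => w z + (-1) * φ z) {z | 0 ≤ z.2 ∧ z.2 ≤ y1 ∧ XX x1 z ≤ η} :=
    hw.add (continuousOn_const.mul hφc.continuous.continuousOn)
  have hmp := MP (n := n) (a := a) ha hD (C := 0) (A := A) le_rfl
    (fun z hz => ⟨hA z hz, by rw [zero_mul]; linarith⟩) hvc
    (by
      rintro z ⟨h1, h2, h3⟩ hzp hneg
      have hz0 := hw0 z h1 h2 h3
      have h4 : XX x1 z < η := by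
        refine lt_of_le_of_ne h3 fun h => ?_
        have : φ z = 0 := by rw [hφ]; simp [h]
        rw [this] at hneg; linarith
      have h5 : z.2 < y1 := by
        refine lt_of_le_of_ne h2 fun h => ?_
        have h6 := htop1 z h h3
        have : φ z ≤ c1 := by
          rw [hφ, ← hκ1]
          simp only
          rw [h, mul_assoc]
          have h7 := XX_nonneg x1 z
          have : (η - XX x1 z) ^ 2 ≤ η ^ 2 := by nlinarith
          gcongr
        linarith
      obtain ⟨hc2, hl⟩ := hLF z hzp h5 h4
      refine ⟨?_, hc2.add (contDiffAt_const.mul hφc.contDiffAt), ?_⟩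
      · filter_upwards [ypos_nhds hzp, continuous_snd.continuousAt.eventually (gt_mem_nhds h5),
          (XX_cont x1).continuousAt.eventually (gt_mem_nhds h4)] with v e1 e2 e3
        exact ⟨e1.le, e2.le, e3.le⟩
      · rw [LF_add hc2 (contDiffAt_const.mul hφc.contDiffAt), LF_cmul]
        have := hφL z hzp h3
        simp; linarith)
  have hfin := closure_nonneg (z := (x1, 0)) (hvc (x1, 0) ⟨le_rfl, hy1.le, by rw [hXx]; exact hη.le⟩) hy1
    (by
      intro t ht ht2
      refine ⟨?_, ?_, ?_⟩
      · rw [y_ey]; simp; linarith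
      · rw [y_ey]; simp; linarith
      · rw [XX_ey, hXx]; exact hη.le)
    (by
      intro t ht ht2
      apply hmp
      · refine ⟨?_, ?_, ?_⟩
        · rw [y_ey]; simp; linarith
        · rw [y_ey]; simp; linarith
        · rw [XX_ey, hXx]; exact hη.le
      · rw [y_ey]; simp; linarith)
  have : 0 < φ (x1, 0) := by
    rw [hφ]; simp only [hXx]; simp; positivity
  linarith

end lbbp

open Set Filter Topology

structure Sol {n : ℕ} (a α : ℝ) (u : EE n → ℝ) : Prop where
  cont : ContinuousOn u {z | 0 ≤ z.2}
  c2 : ∀ z : EE n, 0 < z.2 → ContDiffAt ℝ 2 u z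
  eq : ∀ z : EE n, 0 < z.2 → LF a u z = -(u z) ^ α
  nonneg : ∀ z : EE n, 0 ≤ z.2 → 0 ≤ u z

section solu
variable {n : ℕ} {a α m : ℝ} {u : EE n → ℝ}

theorem sq_le_XX (p : Fin n → ℝ) (z : EE n) (i : Fin n) : (z.1 i - p i) ^ 2 ≤ XX p z :=
  Finset.single_le_sum (f := fun i => (z.1 i - p i) ^ 2) (fun _ _ => sq_nonneg _) (Finset.mem_univ i)

theorem norm_of_XX {p : Fin n → ℝ} {z : EE n} {δ : ℝ} (hδ : 0 < δ) (h : XX p z < δ ^ 2) : ‖z.1 - p‖ < δ := by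
  rw [pi_norm_lt_iff hδ]
  intro i
  rw [Pi.sub_apply, Real.norm_eq_abs]
  exact abs_lt_of_sq_lt_sq (lt_of_le_of_lt (sq_le_XX p z i) h) hδ.le

theorem m_pos (ha : 1 < a) (hm : m = n / 2 + a - 1) : 0 < m := by
  rw [hm]; have : (0:ℝ) ≤ n := Nat.cast_nonneg n
  linarith

theorem Sol.LF_nonpos (h : Sol a α u) {z : EE n} (hz : 0 < z.2) : LF a u z ≤ 0 := by
  rw [h.eq z hz]
  have := Real.rpow_nonneg (h.nonneg z hz.le) α
  linarith

theorem Sol.pos (ha : 1 < a) (h : Sol a α u) (h0 : 0 < u 0) : ∀ z : EE n, 0 ≤ z.2 → 0 < u z := by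
  have hc := h.cont 0 (by simp)
  obtain ⟨δ, hδ, hδu⟩ := Metric.mem_nhdsWithin_iff.1 (hc.eventually (lt_mem_nhds (half_lt_self h0)))
  have hnear : ∀ z : EE n, 0 ≤ z.2 → rh z < min (δ ^ 2) δ → u 0 / 2 < u z := by
    intro z hz hr
    apply hδu
    refine ⟨?_, hz⟩
    have hX := XX_nonneg 0 z
    have h1 : rh z < δ ^ 2 := lt_of_lt_of_le hr (min_le_left _ _)
    have h2 : rh z < δ := lt_of_lt_of_le hr (min_le_right _ _)
    unfold rh at h1 h2
    rw [mem_ball_zero_iff, Prod.norm_def, max_lt_iff]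
    constructor
    · have := norm_of_XX (p := 0) (z := z) hδ (by linarith)
      simpa using this
    · rw [Real.norm_eq_abs, abs_of_nonneg hz]; linarith
  have hmm : 0 < min (δ ^ 2) δ := lt_min (by positivity) hδ
  obtain ⟨r0, hr0, hr1⟩ := exists_between hmm
  intro z hz
  rcases lt_or_ge (rh z) r0 with hr | hr
  · linarith [hnear z hz (by linarith)]
  · have := LB ha hr0 (c := u 0 / 2) (by linarith) rfl (w := u) (h.cont.mono fun z hz => hz.1)
      (fun z hz _ => h.nonneg z hz) (fun z hz _ => ⟨h.c2 z hz, h.LF_nonpos hz⟩)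
      (fun z hz hr => (hnear z hz (by linarith)).le) z hz hr
    refine lt_of_lt_of_le ?_ this
    have : 0 < rh z := by linarith
    positivity

theorem rh_Kv (s : ℝ) {z : EE n} (hz : rh z ≠ 0) : rh (Kv s z) = s ^ 2 / rh z := by
  have e : XX 0 (Kv s z) = (s / rh z) ^ 2 * XX 0 z := by
    simp [XX, Kv, Finset.mul_sum, mul_pow]
  have e2 : rh (Kv s z) = (s / rh z) ^ 2 * XX 0 z + 4 * (s ^ 2 * z.2 / rh z ^ 2) := by
    rw [← e]; rfl
  have e3 : XX 0 z = rh z - 4 * z.2 := by simp [rh]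
  rw [e2, e3]; field_simp; ring

theorem Kv_self {z : EE n} (hz : rh z ≠ 0) : Kv (rh z) z = z := by
  ext j
  · simp [Kv, hz]
  · simp only [Kv]; field_simp

theorem Kv_y (s : ℝ) {z : EE n} (hz : 0 ≤ z.2) : 0 ≤ (Kv s z).2 := by
  simp only [Kv]; positivity

theorem Kv_y' {s : ℝ} (hs : 0 < s) {z : EE n} (hz : 0 < z.2) : 0 < (Kv s z).2 := by
  have := rh_pos hz
  simp only [Kv]; positivity

noncomputable def US (m : ℝ) (u : EE n → ℝ) (s : ℝ) (z : EE n) : ℝ := s ^ m * rh z ^ (-m) * u (Kv s z)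

noncomputable def VS (m : ℝ) (u : EE n → ℝ) (q : ℝ × EE n) : ℝ := q.1 ^ m * u (q.1 • q.2.1, q.1 ^ 2 * q.2.2)

theorem US_VS (s : ℝ) (z : EE n) : US m u s z = rh z ^ (-m) * VS m u (s, Kv 1 z) := by
  have : Kv s z = (s • (Kv 1 z).1, s ^ 2 * (Kv 1 z).2) := by
    ext j
    · simp [Kv]; ring
    · simp [Kv]; ring
  simp only [US, VS, ← this]; ring

theorem VS_cont (hm : 0 < m) (h : Sol a α u) : ContinuousOn (VS m u) {q | 0 ≤ q.2.2} := by
  unfold VS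
  refine ContinuousOn.mul ?_ ?_
  · exact (continuous_fst.rpow_const fun _ => Or.inr hm.le).continuousOn
  · refine h.cont.comp (f := fun q : ℝ × EE n => ((q.1 • q.2.1, q.1 ^ 2 * q.2.2) : EE n)) (by fun_prop) ?_
    intro q hq
    have h1 : 0 ≤ q.2.2 := hq
    show 0 ≤ q.1 ^ 2 * q.2.2
    positivity

theorem US_cont (h : Sol a α u) (s : ℝ) : ContinuousOn (US m u s) {z : EE n | 0 ≤ z.2 ∧ 0 < rh z} := by
  unfold US
  refine ContinuousOn.mul (continuousOn_const.mul (rh_cont.continuousOn.rpow_const ?_)) ?_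
  · intro z hz; left; exact hz.2.ne'
  · refine h.cont.comp (fun z hz => (Kv_c2 s z hz.2.ne').continuousAt.continuousWithinAt) ?_
    intro z hz; exact Kv_y s hz.1

theorem US_nonneg (h : Sol a α u) {s : ℝ} (hs : 0 ≤ s) {z : EE n} (hz : 0 ≤ z.2) : 0 ≤ US m u s z := by
  have := h.nonneg _ (Kv_y s hz)
  have := rh_nonneg hz
  unfold US; positivity

theorem US_self {z : EE n} (hz : 0 < rh z) : US m u (rh z) z = u z := by
  rw [US, Kv_self hz.ne', ← Real.rpow_add hz]; simp

theorem US_zero (hm : 0 < m) (z : EE n) : US m u 0 z = 0 := by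
  rw [US, Real.zero_rpow hm.ne']; ring

theorem US_c2 (hm : 0 < m) (h : Sol a α u) {s : ℝ} (hs : 0 ≤ s) {z : EE n} (hz : 0 < z.2) :
    ContDiffAt ℝ 2 (US m u s) z := by
  rcases hs.eq_or_lt with h0 | h0
  · have : US m u s = fun _ => 0 := by rw [← h0]; funext z; exact US_zero hm z
    rw [this]; exact contDiffAt_const
  · have hr := rh_pos hz
    have hf : ContDiffAt ℝ 2 (fun w : EE n => s ^ m * rh w ^ (-m)) z :=
      ContDiffAt.comp (g := fun t => s ^ m * t ^ (-m)) z (pow_c2 _ _ _ hr) rh_c2.contDiffAt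
    exact hf.mul (ContDiffAt.comp (g := u) z (h.c2 _ (Kv_y' h0 hz)) (Kv_c2 s z hr.ne'))

theorem LF_US (ha : 1 < a) (hm : m = n / 2 + a - 1) (h : Sol a α u) {s κ : ℝ} (hα : 1 < α)
    (hκ : κ = m + 2 - m * α) (hκ0 : 0 < κ) (hs : 0 ≤ s)
    {z : EE n} (hz : 0 < z.2) : LF a (US m u s) z = -((s / rh z) ^ κ * (US m u s z) ^ α) := by
  have hm0 := m_pos ha hm
  have hr := rh_pos hz
  rcases hs.eq_or_lt with h0 | h0
  · have : US m u s = fun _ => 0 := by rw [← h0]; funext z; exact US_zero hm0 z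
    rw [this, LF_const, Real.zero_rpow (by linarith)]; simp
  · have e : US m u s = fun w => s ^ m * rh w ^ (-m) * u (Kv s w) := rfl
    have hK := h.nonneg _ (Kv_y' h0 hz).le
    rw [e, LF_kelvin s (s ^ m) m z hr hm (h.c2 _ (Kv_y' h0 hz)), h.eq _ (Kv_y' h0 hz)]
    have e1 : s ^ m * rh z ^ (-m) = (s / rh z) ^ m := by
      rw [Real.div_rpow hs hr.le, Real.rpow_neg hr.le]; rfl
    simp only [e1]
    have hq : 0 < s / rh z := by positivity
    rw [Real.mul_rpow (by positivity) hK, ← Real.rpow_mul hq.le, ← mul_assoc, ← Real.rpow_add hq, hκ]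
    rw [← Real.rpow_natCast, ← Real.rpow_add hq]
    push_cast
    ring_nf

/-- difference `u - U_s` -/
noncomputable def WS (m : ℝ) (u : EE n → ℝ) (s : ℝ) (z : EE n) : ℝ := u z + (-1) * US m u s z

theorem WS_c2 (hm : 0 < m) (h : Sol a α u) {s : ℝ} (hs : 0 ≤ s) {z : EE n} (hz : 0 < z.2) :
    ContDiffAt ℝ 2 (WS m u s) z :=
  (h.c2 z hz).add (contDiffAt_const.mul (US_c2 hm h hs hz))

theorem WS_cont (h : Sol a α u) (s : ℝ) : ContinuousOn (WS m u s) {z : EE n | 0 ≤ z.2 ∧ 0 < rh z} :=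
  (h.cont.mono fun _ hz => hz.1).add (continuousOn_const.mul (US_cont h s))

theorem LF_WS (ha : 1 < a) (hm : m = n / 2 + a - 1) (h : Sol a α u) {s κ : ℝ} (hα : 1 < α)
    (hκ : κ = m + 2 - m * α) (hκ0 : 0 < κ) (hs : 0 ≤ s) {z : EE n} (hz : 0 < z.2) :
    LF a (WS m u s) z = -(u z) ^ α + (s / rh z) ^ κ * (US m u s z) ^ α := by
  have hm0 := m_pos ha hm
  have : WS m u s = fun w => u w + (-1) * US m u s w := rfl
  rw [this, LF_add (h.c2 z hz) (contDiffAt_const.mul (US_c2 hm0 h hs hz)), LF_cmul, h.eq z hz,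
    LF_US ha hm h hα hκ hκ0 hs hz]
  ring

theorem LF_WS_le (ha : 1 < a) (hm : m = n / 2 + a - 1) (h : Sol a α u) {s κ : ℝ} (hα : 1 < α)
    (hκ : κ = m + 2 - m * α) (hκ0 : 0 < κ) (hs : 0 ≤ s) {z : EE n} (hz : 0 < z.2) (hsr : s ≤ rh z) :
    LF a (WS m u s) z ≤ (US m u s z) ^ α - (u z) ^ α := by
  rw [LF_WS ha hm h hα hκ hκ0 hs hz]
  have hr := rh_pos hz
  have h1 : (s / rh z) ^ κ ≤ 1 := Real.rpow_le_one (by positivity) (by rw [div_le_one hr]; exact hsr) hκ0.le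
  have h2 := Real.rpow_nonneg (US_nonneg (m := m) h hs hz.le) α
  nlinarith

end solu

open Set Filter Topology

section moving
variable {n : ℕ} {a α m κ : ℝ} {u : EE n → ℝ}

theorem rpow_mvt {α p q M : ℝ} (hα : 1 < α) (hp : 0 ≤ p) (hpq : p < q) (hq : q ≤ M) :
    q ^ α - p ^ α ≤ α * M ^ (α - 1) * (q - p) := by
  have hq0 : 0 < q := by linarith
  have h1 := one_add_mul_self_le_rpow_one_add (s := p / q - 1) (p := α)
    (by have : 0 ≤ p / q := by positivity
        linarith) hα.le
  have e : 1 + (p / q - 1) = p / q := by ring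
  rw [e, Real.div_rpow hp hq0.le, le_div_iff₀ (Real.rpow_pos_of_pos hq0 _)] at h1
  have e2 : q ^ α = q ^ (α - 1) * q := by
    rw [← Real.rpow_add_one hq0.ne']; ring_nf
  have e3 : (1 + α * (p / q - 1)) * q ^ α = q ^ α + α * q ^ (α - 1) * (p - q) := by
    rw [e2]; field_simp
  rw [e3] at h1
  have h2 : q ^ (α - 1) ≤ M ^ (α - 1) := Real.rpow_le_rpow hq0.le hq (by linarith)
  have h3 : α * q ^ (α - 1) * (q - p) ≤ α * M ^ (α - 1) * (q - p) := by
    have : 0 ≤ q - p := by linarith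
    gcongr
  linarith

def PP (m : ℝ) (u : EE n → ℝ) (s : ℝ) : Prop := ∀ z : EE n, 0 ≤ z.2 → s ≤ rh z → 0 < rh z → 0 ≤ WS m u s z

theorem PP_LF (ha : 1 < a) (hm : m = n / 2 + a - 1) (h : Sol a α u) (hα : 1 < α)
    (hκ : κ = m + 2 - m * α) (hκ0 : 0 < κ) {s : ℝ} (hs : 0 ≤ s) (hP : PP m u s)
    {z : EE n} (hz : 0 < z.2) (hr : s ≤ rh z) : LF a (WS m u s) z ≤ 0 := by
  have h1 := LF_WS_le ha hm h hα hκ hκ0 hs hz hr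
  have h2 := hP z hz.le hr (rh_pos hz)
  have h3 : US m u s z ^ α ≤ u z ^ α :=
    Real.rpow_le_rpow (US_nonneg h hs hz.le) (by unfold WS at h2; linarith) (by linarith)
  linarith

theorem PP_strict (ha : 1 < a) (hm : m = n / 2 + a - 1) (h : Sol a α u) (hα : 1 < α)
    (hκ : κ = m + 2 - m * α) (hκ0 : 0 < κ) (hpos : ∀ z : EE n, 0 ≤ z.2 → 0 < u z) {s : ℝ} (hs : 0 ≤ s)
    (hP : PP m u s) : ∀ z : EE n, 0 ≤ z.2 → s < rh z → 0 < WS m u s z := by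
  have hm0 := m_pos ha hm
  have key : ∀ z : EE n, 0 < z.2 → s < rh z → 0 < WS m u s z := by
    intro z hz hr
    refine lt_of_le_of_ne (hP z hz.le hr.le (rh_pos hz)) fun h0 => ?_
    have hloc : IsLocalMin (WS m u s) z := by
      filter_upwards [ypos_nhds hz, rh_cont.continuousAt.eventually (lt_mem_nhds hr)] with v e1 e2
      rw [← h0]
      exact hP v e1.le e2.le (rh_pos e1)
    have h1 := LF_min (a := a) hz (WS_c2 hm0 h hs hz) hloc
    rw [LF_WS ha hm h hα hκ hκ0 hs hz] at h1
    have e : US m u s z = u z := by unfold WS at h0; linarith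
    rw [e] at h1
    have h2 : (s / rh z) ^ κ < 1 :=
      Real.rpow_lt_one (by have := rh_pos hz; positivity) (by rw [div_lt_one (rh_pos hz)]; exact hr) hκ0
    have h3 : 0 < u z ^ α := Real.rpow_pos_of_pos (hpos z hz.le) _
    nlinarith
  intro z hz hr
  rcases hz.eq_or_lt with h0 | h0
  · obtain ⟨x1, y⟩ := z
    simp only at h0
    subst h0
    have hc : Continuous fun x : Fin n → ℝ => XX 0 ((x, 0) : EE n) := (XX_cont 0).comp (by fun_prop)
    have hr' : s < XX 0 ((x1, 0) : EE n) := by unfold rh at hr; simpa using hr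
    obtain ⟨δ, hδ, hδu⟩ := Metric.mem_nhds_iff.1 (hc.continuousAt.eventually (lt_mem_nhds hr'))
    have hin : ∀ z : EE n, 0 ≤ z.2 → XX x1 z ≤ δ ^ 2 / 2 → s < rh z := by
      intro z hz hX
      have h1 : ‖z.1 - x1‖ < δ := norm_of_XX hδ (by nlinarith)
      have h2 : s < XX 0 ((z.1, 0) : EE n) := hδu (by rw [mem_ball_iff_norm]; exact h1)
      have h3 : XX 0 ((z.1, 0) : EE n) = XX 0 z := rfl
      unfold rh; linarith
    refine BP ha (x1 := x1) (η := δ ^ 2 / 2) (y1 := 1) (by positivity) one_pos ((WS_cont h s).mono ?_) ?_ ?_ ?_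
    · rintro z ⟨h1, h2, h3⟩
      exact ⟨h1, by linarith [hin z h1 h3]⟩
    · intro z h1 h2 h3
      have := hin z h1 h3
      exact hP z h1 this.le (by linarith)
    · intro z h1 h2 h3
      exact ⟨WS_c2 hm0 h hs h1, PP_LF ha hm h hα hκ hκ0 hs hP h1 (hin z h1.le h3.le).le⟩
    · intro z h1 h3
      have : 0 < z.2 := by rw [h1]; exact one_pos
      exact key z this (hin z this.le h3)
  · exact key z h0 hr

theorem V_unif (hm : 0 < m) (h : Sol a α u) {s ρ e : ℝ} (he : 0 < e) :
    ∃ ε > 0, ∀ s', s ≤ s' → s' < s + ε → ∀ ζ : EE n, 0 ≤ ζ.2 → rh ζ ≤ ρ →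
      |VS m u (s', ζ) - VS m u (s, ζ)| < e := by
  have hK : IsCompact (Icc s (s + 1) ×ˢ {ζ : EE n | 0 ≤ ζ.2 ∧ rh ζ ≤ ρ}) := isCompact_Icc.prod (compact_rh ρ)
  have hu := hK.uniformContinuousOn_of_continuous ((VS_cont hm h).mono fun q hq => hq.2.1)
  obtain ⟨δ, hδ, hd⟩ := Metric.uniformContinuousOn_iff.1 hu e he
  refine ⟨min δ 1, lt_min hδ one_pos, fun s' h1 h2 ζ h3 h4 => ?_⟩
  have h5 : s' < s + δ := lt_of_lt_of_le h2 (by gcongr; exact min_le_left _ _)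
  have h6 : s' < s + 1 := lt_of_lt_of_le h2 (by gcongr; exact min_le_right _ _)
  have := hd (s', ζ) ⟨⟨h1, h6.le⟩, h3, h4⟩ (s, ζ) ⟨⟨le_rfl, by simp⟩, h3, h4⟩
    (by rw [Prod.dist_eq, dist_self, max_lt_iff]
        refine ⟨?_, hδ⟩
        rw [Real.dist_eq, abs_of_nonneg (by simpa using h1)]
        simp only; linarith)
  rwa [Real.dist_eq] at this

theorem PP_step (ha : 1 < a) (hm : m = n / 2 + a - 1) (h : Sol a α u) (hα : 1 < α)
    (hκ : κ = m + 2 - m * α) (hκ0 : 0 < κ) (hpos : ∀ z : EE n, 0 ≤ z.2 → 0 < u z) {s : ℝ} (hs : 0 ≤ s)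
    (hP : PP m u s) : ∃ ε > 0, ∀ s', s < s' → s' < s + ε → PP m u s' := by
  have hm0 := m_pos ha hm
  have hn0 : (0:ℝ) ≤ n := Nat.cast_nonneg n
  have hst := PP_strict ha hm h hα hκ hκ0 hpos hs hP
  obtain ⟨M, hM0, hM⟩ : ∃ M > 0, ∀ z : EE n, 0 ≤ z.2 → rh z ≤ s + 1 → u z ≤ M := by
    obtain ⟨B, hB⟩ := (compact_rh (n := n) (s + 1)).bddAbove_image (h.cont.mono fun z hz => hz.1)
    refine ⟨max B 1, by positivity, fun z hz hr => ?_⟩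
    exact le_trans (hB (mem_image_of_mem u ⟨hz, hr⟩)) (le_max_left _ _)
  obtain ⟨C, hC⟩ : ∃ C, C = α * M ^ (α - 1) := ⟨_, rfl⟩
  have hC0 : 0 < C := by rw [hC]; positivity
  obtain ⟨δ, hδ⟩ : ∃ δ, δ = min (1 / 2) (a / (C + 1)) := ⟨_, rfl⟩
  have hδ0 : 0 < δ := by rw [hδ]; positivity
  have hδ1 : δ ≤ 1 / 2 := by rw [hδ]; exact min_le_left _ _
  have hδ2 : 2 * δ * C < 2 * n + 4 * a := by
    have : δ ≤ a / (C + 1) := by rw [hδ]; exact min_le_right _ _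
    rw [le_div_iff₀ (by linarith)] at this
    nlinarith
  obtain ⟨r1, hr1⟩ : ∃ r1, r1 = s + δ := ⟨_, rfl⟩
  have hr10 : 0 < r1 := by linarith
  obtain ⟨c0, hc0, hc0w⟩ : ∃ c0 > 0, ∀ z : EE n, 0 ≤ z.2 → rh z = r1 → c0 ≤ WS m u s z := by
    obtain ⟨z2, hz2, hmin⟩ := (compact_ann (n := n) r1 r1).exists_isMinOn (f := WS m u s)
      ⟨(0, r1 / 4), by
        have : rh ((0, r1 / 4) : EE n) = r1 := by simp [rh, XX]; ring
        refine ⟨?_, by rw [this], by rw [this]⟩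
        simp; linarith⟩
      ((WS_cont h s).mono fun z hz => ⟨hz.1, by linarith [hz.2.1]⟩)
    refine ⟨_, hst z2 hz2.1 (by linarith [hz2.2.1]), fun z hz hr => hmin ⟨hz, hr.ge, hr.le⟩⟩
  have hlb := LB ha hr10 hc0.le hm (w := WS m u s) ((WS_cont h s).mono fun z hz => ⟨hz.1, by linarith [hz.2]⟩)
    (fun z hz hr => (hst z hz (by linarith)).le)
    (fun z hz hr => ⟨WS_c2 hm0 h hs hz, PP_LF ha hm h hα hκ hκ0 hs hP hz (by linarith)⟩) hc0w
  have he : 0 < c0 * r1 ^ m := by positivity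
  obtain ⟨ε1, hε1, hV⟩ := V_unif hm0 h (s := s) (ρ := 1 / r1) he
  refine ⟨min ε1 δ, lt_min hε1 hδ0, fun s' hs1 hs2 => ?_⟩
  have hs3 : s' < s + ε1 := lt_of_lt_of_le hs2 (by gcongr; exact min_le_left _ _)
  have hs4 : s' < s + δ := lt_of_lt_of_le hs2 (by gcongr; exact min_le_right _ _)
  have hs0 : 0 < s' := by linarith
  have hfar : ∀ z : EE n, 0 ≤ z.2 → r1 ≤ rh z → 0 ≤ WS m u s' z := by
    intro z hz hr
    have hrp : 0 < rh z := by linarith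
    have h1 := hlb z hz hr
    have h2 := hV s' hs1.le hs3 (Kv 1 z) (Kv_y 1 hz) (by
      rw [rh_Kv 1 hrp.ne', one_pow]; exact one_div_le_one_div_of_le hr10 hr)
    have h3 := (abs_lt.1 h2).2
    have h4 : 0 < rh z ^ (-m) := Real.rpow_pos_of_pos hrp _
    unfold WS at h1 ⊢
    rw [US_VS] at h1 ⊢
    nlinarith
  have hmp := MP (n := n) (a := a) ha (compact_ann s' r1) (C := C) (A := s + 2 * δ) hC0.le
    (by
      rintro z ⟨h1, h2, h3⟩
      refine ⟨by linarith, ?_⟩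
      nlinarith)
    (w := WS m u s') ((WS_cont h s').mono fun z hz => ⟨hz.1, by linarith [hz.2.1]⟩)
    (by
      rintro z ⟨h1, h2, h3⟩ hzp hneg
      have hrp := rh_pos hzp
      have h4 : s' < rh z := by
        refine lt_of_le_of_ne h2 fun hh => ?_
        unfold WS at hneg
        rw [hh, US_self hrp] at hneg
        linarith
      have h5 : rh z < r1 := by
        by_contra hh
        linarith [hfar z h1 (not_lt.1 hh)]
      refine ⟨?_, WS_c2 hm0 h hs0.le hzp, ?_⟩
      · filter_upwards [ypos_nhds hzp, rh_cont.continuousAt.eventually (lt_mem_nhds h4),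
          rh_cont.continuousAt.eventually (gt_mem_nhds h5)] with v e1 e2 e3
        exact ⟨e1.le, e2.le, e3.le⟩
      · refine (LF_WS_le ha hm h hα hκ hκ0 hs0.le hzp h2).trans ?_
        have hU : US m u s' z ≤ M := by
          have g1 : rh (Kv s' z) ≤ s + 1 := by
            rw [rh_Kv s' hrp.ne', div_le_iff₀ hrp]
            nlinarith
          have g2 := hM _ (Kv_y s' h1) g1
          have g3 := h.nonneg _ (Kv_y s' h1)
          have g4 : s' ^ m * rh z ^ (-m) ≤ 1 := by
            rw [Real.rpow_neg hrp.le, ← div_eq_mul_inv, div_le_one (by positivity)]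
            exact Real.rpow_le_rpow hs0.le h2 hm0.le
          unfold US
          nlinarith
        unfold WS at hneg ⊢
        have := rpow_mvt hα (h.nonneg z h1) (show u z < US m u s' z by linarith) hU
        rw [← hC] at this
        linarith)
  intro z hz hr hrp
  rcases le_or_gt r1 (rh z) with hh | hh
  · exact hfar z hz hh
  · refine closure_nonneg (z := z) (WS_cont h s' z ⟨hz, hrp⟩) (η := (r1 - rh z) / 4) (by linarith) ?_ ?_
    · intro t ht _
      refine ⟨?_, ?_⟩
      · rw [y_ey]; linarith
      · rw [rh_ey]; linarith
    · intro t ht ht2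
      apply hmp
      · refine ⟨?_, ?_, ?_⟩
        · rw [y_ey]; linarith
        · rw [rh_ey]; linarith
        · rw [rh_ey]; linarith
      · rw [y_ey]; linarith

theorem PP_all (ha : 1 < a) (hm : m = n / 2 + a - 1) (h : Sol a α u) (hα : 1 < α)
    (hκ : κ = m + 2 - m * α) (hκ0 : 0 < κ) (hpos : ∀ z : EE n, 0 ≤ z.2 → 0 < u z) {T : ℝ} (hT : 0 ≤ T) :
    PP m u T := by
  have hm0 := m_pos ha hm
  have hcl : IsClosed ({s | PP m u s} ∩ Icc 0 T) := by
    have e : {s | PP m u s} ∩ Icc 0 T = Icc 0 T ∩ ⋂ z : {z : EE n // 0 ≤ z.2 ∧ 0 < rh z},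
        (Ici (rh z.1) ∪ {s | 0 ≤ WS m u s z.1}) := by
      ext s
      simp only [mem_inter_iff, mem_setOf_eq, mem_iInter, mem_union, mem_Ici, PP]
      constructor
      · rintro ⟨h1, h2⟩
        refine ⟨h2, fun z => ?_⟩
        rcases le_or_gt (rh z.1) s with hh | hh
        · exact Or.inl hh
        · exact Or.inr (h1 z.1 z.2.1 hh.le z.2.2)
      · rintro ⟨h1, h2⟩
        refine ⟨fun z hz hr hrp => ?_, h1⟩
        rcases h2 ⟨z, hz, hrp⟩ with hh | hh
        · have : s = rh z := le_antisymm hr hh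
          unfold WS
          rw [this, US_self hrp]; simp
        · exact hh
    rw [e]
    refine isClosed_Icc.inter (isClosed_iInter fun z => isClosed_Ici.union ?_)
    have hc : Continuous fun s => WS m u s z.1 := by
      unfold WS
      simp only [US_VS]
      have : Continuous fun s => VS m u (s, Kv 1 z.1) := by
        rw [← continuousOn_univ]
        exact (VS_cont hm0 h).comp (f := fun s : ℝ => (s, Kv 1 z.1)) (by fun_prop) (fun s _ => Kv_y 1 z.2.1)
      fun_prop
    exact isClosed_le continuous_const hc
  have h0 : PP m u 0 := by
    intro z hz _ _
    unfold WS; rw [US_zero hm0]; linarith [hpos z hz]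
  have := hcl.Icc_subset_of_forall_exists_gt h0 (by
    rintro s ⟨hs, hs0, hsT⟩ y hy
    obtain ⟨ε, hε, hP⟩ := PP_step ha hm h hα hκ hκ0 hpos hs0 hs
    have hy' : s < y := hy
    obtain ⟨s', h1, h2⟩ := exists_between (show s < min (s + ε) y from lt_min (by linarith) hy')
    exact ⟨s', hP s' h1 (lt_of_lt_of_le h2 (min_le_left _ _)), h1, (lt_of_lt_of_le h2 (min_le_right _ _)).le⟩)
  exact this ⟨hT, le_rfl⟩

end moving

open Set Filter Topology

section final
variable {n : ℕ} {a α m κ : ℝ} {u : EE n → ℝ}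

theorem lower (ha : 1 < a) (hm : m = n / 2 + a - 1) (h : Sol a α u) (hα : 1 < α)
    (hκ : κ = m + 2 - m * α) (hκ0 : 0 < κ) (hpos : ∀ z : EE n, 0 ≤ z.2 → 0 < u z) :
    ∃ c > 0, ∀ z : EE n, 0 ≤ z.2 → 1 ≤ rh z → c * rh z ^ (-(m / 2)) ≤ u z := by
  obtain ⟨c, hc, hcw⟩ : ∃ c > 0, ∀ z : EE n, 0 ≤ z.2 → rh z = 1 → c ≤ u z := by
    obtain ⟨z2, hz2, hmin⟩ := (compact_ann (n := n) 1 1).exists_isMinOn (f := u)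
      ⟨(0, 1 / 4), by
        have : rh ((0, 1 / 4) : EE n) = 1 := by simp [rh, XX]
        refine ⟨?_, by rw [this], by rw [this]⟩
        simp⟩
      (h.cont.mono fun z hz => hz.1)
    exact ⟨_, hpos z2 hz2.1, fun z hz hr => hmin ⟨hz, hr.ge, hr.le⟩⟩
  refine ⟨c, hc, fun z hz hr => ?_⟩
  have hrp : 0 < rh z := by linarith
  have hP := PP_all ha hm h hα hκ hκ0 hpos (Real.sqrt_nonneg (rh z)) z hz
    (by rw [Real.sqrt_le_left hrp.le]; nlinarith) hrp
  have h1 : rh (Kv (Real.sqrt (rh z)) z) = 1 := by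
    rw [rh_Kv _ hrp.ne', Real.sq_sqrt hrp.le]; field_simp
  have h2 := hcw _ (Kv_y _ hz) h1
  have h3 : Real.sqrt (rh z) ^ m * rh z ^ (-m) = rh z ^ (-(m / 2)) := by
    rw [Real.sqrt_eq_rpow, ← Real.rpow_mul hrp.le, ← Real.rpow_add hrp]; ring_nf
  unfold WS US at hP
  rw [h3] at hP
  have h4 : 0 < rh z ^ (-(m / 2)) := Real.rpow_pos_of_pos hrp _
  nlinarith

theorem quad_pos {b K P : ℝ} (hK : 0 < K) (h : b ^ 2 < 32 * K) : 0 < 8 - b * P + K * P ^ 2 := by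
  have h1 := sq_nonneg (2 * K * P - b)
  have h2 : 0 < 4 * K * (8 - b * P + K * P ^ 2) := by nlinarith
  exact pos_of_mul_pos_right h2 (by linarith)

set_option maxHeartbeats 1000000 in
theorem coreA (ha : 1 < a) (hm : m = n / 2 + a - 1) (h : Sol a α u) (hα : 1 < α)
    (hκ : κ = m + 2 - m * α) (hκ0 : 0 < κ) (h0 : 0 < u 0) : False := by
  have hm0 := m_pos ha hm
  have hn0 : (0:ℝ) ≤ n := Nat.cast_nonneg n
  have hpos := h.pos ha h0
  obtain ⟨c, hc, hlow⟩ := lower ha hm h hα hκ hκ0 hpos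
  obtain ⟨B0, hB0⟩ : ∃ B0 : ℝ, B0 = 2 * n + 6 + 2 * a := ⟨_, rfl⟩
  obtain ⟨K, hK⟩ : ∃ K, K = (8 + 2 * B0) ^ 2 / 32 + 1 := ⟨_, rfl⟩
  have hK0 : 0 < K := by rw [hK]; positivity
  obtain ⟨θ, hθ⟩ : ∃ θ, θ = m / 2 * (α - 1) := ⟨_, rfl⟩
  have hθ1 : 0 < 1 - θ := by rw [hθ]; nlinarith
  obtain ⟨c', hc'⟩ : ∃ c', c' = c ^ (α - 1) * 13 ^ (-θ) := ⟨_, rfl⟩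
  have hc'0 : 0 < c' := by rw [hc']; positivity
  obtain ⟨R, hRK, hR1⟩ := (((tendsto_rpow_atTop hθ1).eventually_ge_atTop (K / c')).and
    (eventually_ge_atTop (1:ℝ))).exists
  have hR0 : 0 < R := by linarith
  -- q and phi
  obtain ⟨B, hB⟩ : ∃ B : ℝ → ℝ, B = fun y => (y / R - 2) ^ 2 := ⟨_, rfl⟩
  have hBc : ContDiff ℝ 2 B := by rw [hB]; fun_prop
  have hBd : deriv B = fun y => 2 * (y / R - 2) / R := by
    rw [hB]; funext t
    have := (((hasDerivAt_id' t).div_const R).sub_const 2).fun_pow 2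
    rw [this.deriv]; simp; ring
  have hBdd : deriv (deriv B) = fun y => 2 / R ^ 2 := by
    rw [hBd]; funext t
    have := ((((hasDerivAt_id' t).div_const R).sub_const 2).const_mul 2).div_const R
    rw [this.deriv]; field_simp
  have hkd : deriv (fun t : ℝ => (1 - t) ^ 2) = fun t => -2 * (1 - t) := by
    funext t
    have := (((hasDerivAt_id' t).const_sub 1).fun_pow 2)
    rw [this.deriv]; simp
  have hkdd : deriv (deriv (fun t : ℝ => (1 - t) ^ 2)) = fun t => 2 := by
    rw [hkd]; funext t
    have := ((hasDerivAt_id' t).const_sub 1).const_mul (-2)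
    rw [this.deriv]; ring
  obtain ⟨q, hq⟩ : ∃ q : EE n → ℝ, q = fun w => (1 / R) * XX 0 w + B w.2 := ⟨_, rfl⟩
  have hqc : ∀ z, ContDiffAt ℝ 2 q z := fun z => by
    rw [hq]; exact sum_c2 0 _ hBc.contDiffAt
  have hqcont : Continuous q := continuous_iff_continuousAt.2 fun z => (hqc z).continuousAt
  have hqz : ∀ z, q z = (1 / R) * XX 0 z + (z.2 / R - 2) ^ 2 := fun z => by rw [hq, hB]
  have hbd : ∀ z, q z ≤ 1 → R ≤ z.2 ∧ z.2 ≤ 3 * R ∧ XX 0 z ≤ R := by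
    intro z hz
    rw [hqz] at hz
    have hX := XX_nonneg 0 z
    have h1 : 0 ≤ (1 / R) * XX 0 z := by positivity
    have h2 : (z.2 / R - 2) ^ 2 ≤ 1 := by linarith
    have h3 : -1 ≤ z.2 / R - 2 := by nlinarith
    have h4 : z.2 / R - 2 ≤ 1 := by nlinarith
    have h5 : 1 ≤ z.2 / R := by linarith
    have h6 : z.2 / R ≤ 3 := by linarith
    rw [le_div_iff₀ hR0] at h5
    rw [div_le_iff₀ hR0] at h6
    refine ⟨by linarith, h6, ?_⟩
    have h7 : (1 / R) * XX 0 z ≤ 1 := by nlinarith [sq_nonneg (z.2 / R - 2)]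
    rw [div_mul_eq_mul_div, one_mul, div_le_one hR0] at h7
    exact h7
  obtain ⟨φ, hφ⟩ : ∃ φ : EE n → ℝ, φ = fun w => (fun t : ℝ => (1 - t) ^ 2) (q w) := ⟨_, rfl⟩
  have hφc : ∀ z, ContDiffAt ℝ 2 φ z := fun z => by
    have := hqc z
    rw [hφ]; exact (contDiffAt_const.sub this).pow 2
  have hφL : ∀ z, q z ≤ 1 → 0 < LF a φ z + K / R * φ z := by
    intro z hz
    obtain ⟨g1, g2, g3⟩ := hbd z hz
    have e : LF a φ z = 2 * GG q q z + -2 * (1 - q z) * LF a q z := by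
      rw [hφ, LF_comp (k := fun t : ℝ => (1 - t) ^ 2) (hqc z) (by fun_prop), hkdd, hkd]
    have e1 : GG q q z = 4 * (1 / R) ^ 2 * XX 0 z + z.2 * (2 * (z.2 / R - 2) / R) ^ 2 := by
      rw [hq, GG_sum 0 _ hBc.contDiffAt, hBd]
    have e2 : LF a q z = 2 * n * (1 / R) + z.2 * (2 / R ^ 2) + a * (2 * (z.2 / R - 2) / R) := by
      rw [hq, LF_sum 0 _ hBc.contDiffAt, hBdd, hBd]
    have l1 : 4 * q z ≤ R * GG q q z := by
      have : R * GG q q z = 4 * ((1 / R) * XX 0 z + (z.2 / R) * (z.2 / R - 2) ^ 2) := by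
        rw [e1]; field_simp; ring
      rw [this, hqz]
      have : 1 ≤ z.2 / R := by rw [le_div_iff₀ hR0]; linarith
      nlinarith [sq_nonneg (z.2 / R - 2)]
    have l2 : R * LF a q z ≤ B0 := by
      have : R * LF a q z = 2 * n + 2 * (z.2 / R) + 2 * a * (z.2 / R - 2) := by
        rw [e2]; field_simp
      rw [this, hB0]
      have : z.2 / R ≤ 3 := by rw [div_le_iff₀ hR0]; linarith
      nlinarith
    have e3 : φ z = (1 - q z) ^ 2 := by rw [hφ]
    have hP0 : 0 ≤ 1 - q z := by linarith
    have l3 : R * (LF a φ z + K / R * φ z) = 2 * (R * GG q q z) - 2 * (1 - q z) * (R * LF a q z) + K * φ z := by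
      rw [e]; field_simp; ring
    have l4 : 0 < R * (LF a φ z + K / R * φ z) := by
      rw [l3, e3]
      set P := 1 - q z with hPdef
      have hqP : q z = 1 - P := by rw [hPdef]; ring
      have l5 : P * (R * LF a q z) ≤ P * B0 := mul_le_mul_of_nonneg_left l2 hP0
      have l6 : 0 < 8 - (8 + 2 * B0) * P + K * P ^ 2 := by
        have hKK : (8 + 2 * B0) ^ 2 < 32 * K := by rw [hK]; ring_nf; linarith
        exact quad_pos hK0 hKK
      rw [hqP] at l1
      linarith
    exact pos_of_mul_pos_right (by linarith) hR0.le
  -- compact set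
  have hDc : IsCompact {z : EE n | q z ≤ 1} := by
    refine (compact_aux (n := n) 0 R (3 * R)).of_isClosed_subset (isClosed_le hqcont continuous_const) ?_
    intro z hz
    obtain ⟨g1, g2, g3⟩ := hbd z hz
    exact ⟨by linarith, g2, g3⟩
  have hz1 : q ((0, 2 * R) : EE n) = 0 := by
    rw [hqz]; simp [XX]
    field_simp; ring
  have hyp : ∀ z : EE n, q z ≤ 1 → 0 < z.2 := fun z hz => by linarith [(hbd z hz).1]
  obtain ⟨z0, hz0, hmax⟩ := hDc.exists_isMaxOn (f := fun z => φ z / u z)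
    ⟨(0, 2 * R), by show q _ ≤ 1; rw [hz1]; exact zero_le_one⟩
    (by
      intro z hz
      have hzp := hyp z hz
      exact ((hφc z).continuousAt.div (h.c2 z hzp).continuousAt (hpos z hzp.le).ne').continuousWithinAt)
  have hz0q : q z0 ≤ 1 := hz0
  have hz0p := hyp z0 hz0q
  have hu0 := hpos z0 hz0p.le
  obtain ⟨l, hl⟩ : ∃ l, l = φ z0 / u z0 := ⟨_, rfl⟩
  have hl0 : 0 < l := by
    have h1 : φ (0, 2 * R) / u (0, 2 * R) ≤ φ z0 / u z0 :=
      hmax (show q _ ≤ 1 by rw [hz1]; exact zero_le_one)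
    have h2 : φ (0, 2 * R) = 1 := by rw [hφ]; simp [hz1]
    rw [h2] at h1
    rw [hl]
    refine lt_of_lt_of_le ?_ h1
    have := hpos ((0, 2 * R) : EE n) (by simp; linarith)
    positivity
  have hφ0 : φ z0 = l * u z0 := by rw [hl]; field_simp
  have hq1 : q z0 < 1 := by
    refine lt_of_le_of_ne hz0q fun hh => ?_
    have : φ z0 = 0 := by rw [hφ]; simp [hh]
    have h2 : 0 < l * u z0 := by positivity
    linarith
  have hloc : IsLocalMin (fun z => l * u z + (-1) * φ z) z0 := by
    filter_upwards [hqcont.continuousAt.eventually (gt_mem_nhds hq1)] with z hz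
    have hup := hpos z (hyp z hz.le).le
    have h1 : φ z / u z ≤ l := by rw [hl]; exact hmax (show q z ≤ 1 from hz.le)
    rw [div_le_iff₀ hup] at h1
    rw [hφ0]; linarith
  have hfin := LF_min (a := a) hz0p ((contDiffAt_const.mul (h.c2 z0 hz0p)).add (contDiffAt_const.mul (hφc z0))) hloc
  rw [LF_add (contDiffAt_const.mul (h.c2 z0 hz0p)) (contDiffAt_const.mul (hφc z0)), LF_cmul, LF_cmul, h.eq z0 hz0p] at hfin
  have hbig : K / R ≤ u z0 ^ (α - 1) := by
    obtain ⟨g1, g2, g3⟩ := hbd z0 hz0q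
    have hX := XX_nonneg 0 z0
    have r1 : rh z0 ≤ 13 * R := by unfold rh; linarith
    have r2 : 1 ≤ rh z0 := by unfold rh; linarith
    have r3 := hlow z0 hz0p.le r2
    have r4 : (13 * R) ^ (-(m / 2)) ≤ rh z0 ^ (-(m / 2)) :=
      Real.rpow_le_rpow_of_nonpos (by linarith) r1 (by linarith)
    have r5 : c * (13 * R) ^ (-(m / 2)) ≤ u z0 := by nlinarith
    have r6 : (c * (13 * R) ^ (-(m / 2))) ^ (α - 1) ≤ u z0 ^ (α - 1) :=
      Real.rpow_le_rpow (by positivity) r5 (by linarith)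
    refine le_trans ?_ r6
    rw [Real.mul_rpow hc.le (by positivity), ← Real.rpow_mul (by positivity), Real.mul_rpow (by norm_num) hR0.le]
    have e1 : -(m / 2) * (α - 1) = -θ := by rw [hθ]; ring
    rw [e1, ← mul_assoc, ← hc', div_le_iff₀ hR0]
    rw [div_le_iff₀ hc'0] at hRK
    have e2 : R ^ (1 - θ) = R ^ (-θ) * R := by rw [← Real.rpow_add_one hR0.ne']; ring_nf
    rw [e2] at hRK
    linarith
  have e2 : u z0 ^ α = u z0 ^ (α - 1) * u z0 := by
    rw [← Real.rpow_add_one hu0.ne']; ring_nf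
  have h1 := hφL z0 hz0q
  have h2 : K / R * φ z0 ≤ l * u z0 ^ α := by
    rw [hφ0, e2]
    have : 0 < l * u z0 := by positivity
    nlinarith
  linarith

theorem LF_shift (f : EE n → ℝ) (p z : EE n) : LF a (fun w => f (w + p)) z = LF a f (z + p) + (z.2 - (z + p).2) * D2 f (z + p) ey := by
  have e : ∀ v : EE n, ∀ t : ℝ, z + t • v + p = z + p + t • v := fun v t => by abel
  simp only [LF, D1, D2, e]
  ring

theorem Sol.shift (h : Sol a α u) (x1 : Fin n → ℝ) : Sol a α (fun w => u (w + (x1, 0))) := by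
  have hy : ∀ z : EE n, (z + (x1, 0)).2 = z.2 := fun z => by simp
  refine ⟨?_, ?_, ?_, ?_⟩
  · refine h.cont.comp (f := fun w : EE n => w + (x1, 0)) (by fun_prop) ?_
    intro z hz
    have : 0 ≤ z.2 := hz
    show 0 ≤ (z + (x1, 0)).2
    rw [hy]; exact this
  · intro z hz
    exact ContDiffAt.comp (g := u) (f := fun w : EE n => w + (x1, 0)) z (h.c2 _ (by rw [hy]; exact hz)) (by fun_prop)
  · intro z hz
    rw [LF_shift, hy, h.eq _ (by rw [hy]; exact hz)]; ring
  · intro z hz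
    exact h.nonneg _ (by rw [hy]; exact hz)

theorem Sol.zero (ha : 1 < a) (hm : m = n / 2 + a - 1) (h : Sol a α u) (hα : 1 < α)
    (hκ : κ = m + 2 - m * α) (hκ0 : 0 < κ) : ∀ z : EE n, 0 ≤ z.2 → u z = 0 := by
  have hb : ∀ x1 : Fin n → ℝ, u (x1, 0) = 0 := by
    intro x1
    by_contra hne
    have hp : 0 < u (x1, 0) := lt_of_le_of_ne (h.nonneg _ (le_refl (0:ℝ))) (Ne.symm hne)
    exact coreA ha hm (h.shift x1) hα hκ hκ0 (by simpa using hp)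
  intro z hz
  by_contra hne
  obtain ⟨x1, y1⟩ := z
  have hp : 0 < u (x1, y1) := lt_of_le_of_ne (h.nonneg _ hz) (Ne.symm hne)
  have hy1 : 0 < y1 := by
    refine lt_of_le_of_ne hz fun hh => ?_
    rw [← hh, hb] at hp
    exact lt_irrefl _ hp
  have hc : ContinuousAt (fun x : Fin n → ℝ => u (x, y1)) x1 :=
    ContinuousAt.comp (g := u) (f := fun x : Fin n → ℝ => ((x, y1) : EE n)) (h.c2 (x1, y1) hy1).continuousAt (by fun_prop)
  obtain ⟨δ, hδ, hδu⟩ := Metric.mem_nhds_iff.1 (hc.eventually (lt_mem_nhds hp))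
  have := BP ha (x1 := x1) (η := δ ^ 2 / 2) (y1 := y1) (w := u) (by positivity) hy1
    (h.cont.mono fun z hz => hz.1) (fun z hz _ _ => h.nonneg z hz)
    (fun z hz _ _ => ⟨h.c2 z hz, h.LF_nonpos hz⟩)
    (by
      rintro ⟨x, y⟩ hy hX
      simp only at hy
      subst hy
      have h1 : ‖x - x1‖ < δ := norm_of_XX (z := (x, y)) hδ (by nlinarith)
      exact hδu (by rw [mem_ball_iff_norm]; exact h1))
  rw [hb] at this
  exact lt_irrefl _ this

end final


theorem sol_of_eq (n : ℕ) (a α : ℝ) (u : (Fin n → ℝ) × ℝ → ℝ)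
    (hreg : ContDiffOn ℝ 2 u {p : (Fin n → ℝ) × ℝ | 0 ≤ p.2})
    (hnonneg : ∀ (x : Fin n → ℝ) (y : ℝ), 0 ≤ y → 0 ≤ u (x, y))
    (heq : ∀ (x : Fin n → ℝ) (y : ℝ), 0 < y →
      y * pdyy n u x y + a * pdy n u x y + (∑ i, pdxx n u i x y) + u (x, y) ^ α = 0) :
    Sol a α u := by
  refine ⟨hreg.continuousOn, ?_, ?_, fun z hz => hnonneg z.1 z.2 hz⟩
  · intro z hz
    refine hreg.contDiffAt ?_
    filter_upwards [ypos_nhds hz] with w hw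
    exact hw.le
  · rintro ⟨x, y⟩ hz
    have h := heq x y hz
    have hy : ∀ t : ℝ, ((x, y) : EE n) + t • ey = (x, y + t) := fun t => by
      ext j
      · simp [ey]
      · simp [ey]
    have hx : ∀ (i : Fin n) (t : ℝ), ((x, y) : EE n) + t • ex i = (Function.update x i (x i + t), y) := fun i t => by
      ext j
      · by_cases hj : j = i
        · subst hj; simp [ex]
        · simp [ex, hj]
      · simp [ex]
    have e1 : D1 u (x, y) ey = pdy n u x y := by
      simp only [D1, pdy, hy]
      rw [deriv_comp_const_add (f := fun t => u (x, t)), add_zero]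
    have e2 : D2 u (x, y) ey = pdyy n u x y := by
      simp only [D2, pdyy, hy]
      have : deriv (fun t => u (x, y + t)) = fun t => deriv (fun s => u (x, s)) (y + t) := by
        funext t; exact deriv_comp_const_add (f := fun t => u (x, t)) y t
      rw [this, deriv_comp_const_add (f := fun t => deriv (fun s => u (x, s)) t), add_zero]
    have e3 : ∀ i, D2 u (x, y) (ex i) = pdxx n u i x y := by
      intro i
      simp only [D2, pdxx, hx]
      have : deriv (fun t => u (Function.update x i (x i + t), y))
          = fun t => deriv (fun s => u (Function.update x i s, y)) (x i + t) := by
        funext t; exact deriv_comp_const_add (f := fun t => u (Function.update x i t, y)) (x i) t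
      rw [this, deriv_comp_const_add (f := fun t => deriv (fun s => u (Function.update x i s, y)) t), add_zero]
    simp only [LF, e1, e2, e3]
    linarith

/-- Theorem 1.1(1): the subcritical Liouville theorem for
`y u_yy + a u_y + Δₓ u + u^α = 0` in the upper half-space. -/
theorem liouville_subcritical (n : ℕ) (hn : 1 ≤ n) (a α : ℝ) (ha : 1 < a)
    (hα₁ : 1 < α) (hα₂ : α < (n + 2 * a + 2) / (n + 2 * a - 2))
    (u : (Fin n → ℝ) × ℝ → ℝ)
    (hreg : ContDiffOn ℝ 2 u {p : (Fin n → ℝ) × ℝ | 0 ≤ p.2})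
    (hnonneg : ∀ (x : Fin n → ℝ) (y : ℝ), 0 ≤ y → 0 ≤ u (x, y))
    (heq : ∀ (x : Fin n → ℝ) (y : ℝ), 0 < y →
      y * pdyy n u x y + a * pdy n u x y + (∑ i, pdxx n u i x y) + u (x, y) ^ α = 0) :
    ∀ (x : Fin n → ℝ) (y : ℝ), 0 ≤ y → u (x, y) = 0 := by
  have hn0 : (1:ℝ) ≤ n := by exact_mod_cast hn
  have hm0 : 0 < (n:ℝ) + 2 * a - 2 := by linarith
  rw [lt_div_iff₀ hm0] at hα₂
  intro x y hy
  exact Sol.zero (m := n / 2 + a - 1) ha rfl (sol_of_eq n a α u hreg hnonneg heq) hα₁ rfl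
    (by nlinarith) (x, y) hy
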